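/- arXiv:1305.6069 — 15 statements merged into one kernel-verified Lean document; each statement's English description precedes it below -/
import Mathlib

section
/- Let (X, p) be a paranormed space and let ψ : [0,∞) → [0,∞) be a strictly increasing subadditive bijection. Assume (X, p) is uniformly convex with modulus of convexity δ : Δ → (0,∞). Then for every pair (r, ε) with r, ε > 0 and ψ⁻¹(ε) < 2ψ⁻¹(r), the number δ_ψ(r, ε) := r − ψ(ψ⁻¹(r) − δ(ψ⁻¹(r), ψ⁻¹(ε))) lies in (0, r), and for all x, y ∈ X with ψ(p(x)) ≤ r, ψ(p(y)) ≤ r and ψ(p(x−y)) ≥ ε one has ψ(p((x+y)/2)) ≤ r − δ_ψ(r, ε). -/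
open Filter Topology

/-- If `(X, p)` is a uniformly convex paranormed space with modulus of
convexity `δ` and `ψ` is a strictly increasing subadditive bijection of `[0,∞)`,
then `(X, ψ ∘ p)` is uniformly convex with modulus
`δ_ψ(r, ε) = r − ψ(ψ⁻¹(r) − δ(ψ⁻¹(r), ψ⁻¹(ε)))`. -/
theorem psi_comp_uniformly_convex {X : Type*} [AddCommGroup X] [Module ℝ X]
    (p : X → ℝ) (ψ ψinv : ℝ → ℝ) (δ : ℝ → ℝ → ℝ)
    (hp0 : ∀ x : X, p x = 0 ↔ x = 0)
    (hpneg : ∀ x : X, p (-x) = p x)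
    (hpadd : ∀ x y : X, p (x + y) ≤ p x + p y)
    (hpcont : ∀ (t : ℕ → ℝ) (t₀ : ℝ) (x : ℕ → X) (x₀ : X),
      Tendsto t atTop (𝓝 t₀) → Tendsto (fun n => p (x n - x₀)) atTop (𝓝 0) →
      Tendsto (fun n => p (t n • x n - t₀ • x₀)) atTop (𝓝 0))
    (hψmono : StrictMonoOn ψ (Set.Ici 0))
    (hψbij : Set.BijOn ψ (Set.Ici 0) (Set.Ici 0))
    (hψsub : ∀ s t : ℝ, 0 ≤ s → 0 ≤ t → ψ (s + t) ≤ ψ s + ψ t)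
    (hψinv1 : ∀ t : ℝ, 0 ≤ t → ψinv (ψ t) = t)
    (hψinv2 : ∀ u : ℝ, 0 ≤ u → ψ (ψinv u) = u)
    (hψinvnn : ∀ u : ℝ, 0 ≤ u → 0 ≤ ψinv u)
    (hδmem : ∀ r ε : ℝ, 0 < r → 0 < ε → ε < 2 * r → δ r ε ∈ Set.Ioo 0 r)
    (hδuc : ∀ r ε : ℝ, 0 < r → 0 < ε → ε < 2 * r → ∀ x y : X,
      p x ≤ r → p y ≤ r → ε ≤ p (x - y) →
      p ((1 / 2 : ℝ) • (x + y)) ≤ r - δ r ε) :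
    ∀ r ε : ℝ, 0 < r → 0 < ε → ψinv ε < 2 * ψinv r →
      (r - ψ (ψinv r - δ (ψinv r) (ψinv ε)) ∈ Set.Ioo 0 r) ∧
      (∀ x y : X, ψ (p x) ≤ r → ψ (p y) ≤ r → ε ≤ ψ (p (x - y)) →
        ψ (p ((1 / 2 : ℝ) • (x + y))) ≤
          r - (r - ψ (ψinv r - δ (ψinv r) (ψinv ε)))) := by
  have hp_nonneg : ∀ x : X, 0 ≤ p x := fun x => by
    have h := hpadd x (-x)
    rw [add_neg_cancel, (hp0 0).2 rfl, hpneg] at h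
    linarith
  have hψ_le : ∀ {s t : ℝ}, 0 ≤ s → 0 ≤ t → (ψ s ≤ ψ t ↔ s ≤ t) :=
    fun hs ht => hψmono.le_iff_le hs ht
  have hψ_lt : ∀ {s t : ℝ}, 0 ≤ s → 0 ≤ t → (ψ s < ψ t ↔ s < t) :=
    fun hs ht => hψmono.lt_iff_lt hs ht
  have hψ_zero : 0 ≤ ψ 0 := hψbij.mapsTo (Set.mem_Ici.2 le_rfl)
  have hψinv_pos : ∀ u : ℝ, 0 < u → 0 < ψinv u := fun u hu => by
    have h0 : ψ 0 ≤ 0 := by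
      have h := (hψ_le le_rfl (hψinvnn 0 le_rfl)).2 (hψinvnn 0 le_rfl)
      rwa [hψinv2 0 le_rfl] at h
    rw [← hψ_lt le_rfl (hψinvnn u hu.le), hψinv2 u hu.le]
    exact h0.trans_lt hu
  intro r ε hr hε hlt
  have hr' := hψinv_pos r hr
  have hε' := hψinv_pos ε hε
  obtain ⟨hδ_pos, hδ_lt⟩ := hδmem _ _ hr' hε' hlt
  have hsub : 0 < ψinv r - δ (ψinv r) (ψinv ε) := sub_pos.2 hδ_lt
  refine ⟨⟨?_, ?_⟩, fun x y hx hy hxy => ?_⟩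
  · have h := (hψ_lt hsub.le hr'.le).2 (sub_lt_self _ hδ_pos)
    rw [hψinv2 r hr.le] at h
    exact sub_pos.2 h
  · exact sub_lt_self _ (hψ_zero.trans_lt ((hψ_lt le_rfl hsub.le).2 hsub))
  · rw [← hψinv2 r hr.le, hψ_le (hp_nonneg _) hr'.le] at hx hy
    rw [← hψinv2 ε hε.le, hψ_le hε'.le (hp_nonneg _)] at hxy
    rw [sub_sub_cancel, hψ_le (hp_nonneg _) hsub.le]
    exact hδuc _ _ hr' hε' hlt x y hx hy hxy
end

section
/- Let (Ω, Σ, μ) be a measure space and let φ : [0,∞) → [0,∞) be a convex bijection (hence φ is increasing and φ(0) = 0). Then for every r ∈ (0,∞) the set {x ∈ S : p_φ(x) ≤ r} is a convex subset of S. -/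
open MeasureTheory

/-- `x` is a `μ`-integrable simple function. -/
def IsIntegrableSimpleFunc {Ω : Type*} [MeasurableSpace Ω] (μ : Measure Ω)
    (x : Ω → ℝ) : Prop :=
  (Set.range x).Finite ∧ Measurable x ∧ Integrable x μ

/-- Composing an integrable simple function with a function vanishing at zero preserves
integrability. -/
theorem IsIntegrableSimpleFunc.integrable_comp {Ω : Type*} [MeasurableSpace Ω] {μ : Measure Ω}
    {x : Ω → ℝ} (hx : IsIntegrableSimpleFunc μ x) {g : ℝ → ℝ} (hg : g 0 = 0) :
    Integrable (fun ω => g (x ω)) μ := by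
  obtain ⟨hfin, hmeas, hint⟩ := hx
  let s : SimpleFunc Ω ℝ := ⟨x, fun a => hmeas (measurableSet_singleton a), hfin⟩
  have hs : s.FinMeasSupp μ := SimpleFunc.integrable_iff_finMeasSupp.1 hint
  exact SimpleFunc.integrable_iff_finMeasSupp.2 (hs.map hg)

/-- Linear combinations of integrable simple functions are integrable simple functions. -/
theorem IsIntegrableSimpleFunc.linear_comb {Ω : Type*} [MeasurableSpace Ω] {μ : Measure Ω}
    {x y : Ω → ℝ} (hx : IsIntegrableSimpleFunc μ x) (hy : IsIntegrableSimpleFunc μ y)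
    (a b : ℝ) : IsIntegrableSimpleFunc μ (fun ω => a * x ω + b * y ω) := by
  refine ⟨(hx.1.image2 (fun s t => a * s + b * t) hy.1).subset ?_,
    (hx.2.1.const_mul a).add (hy.2.1.const_mul b), (hx.2.2.const_mul a).add (hy.2.2.const_mul b)⟩
  rintro _ ⟨ω, rfl⟩
  exact ⟨x ω, ⟨ω, rfl⟩, y ω, ⟨ω, rfl⟩, rfl⟩

/-- A one-sided adjunction between a monotone bijection of `[0,∞)` and its inverse. -/
theorem le_iff_of_monotoneOn_bijOn_Ici {φ φinv : ℝ → ℝ}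
    (hbij : Set.BijOn φ (Set.Ici 0) (Set.Ici 0)) (hmono : MonotoneOn φ (Set.Ici 0))
    (hinv : ∀ t : ℝ, 0 ≤ t → φinv (φ t) = t) {u r : ℝ} (hu : 0 ≤ u) (hr : 0 ≤ r) :
    φinv u ≤ r ↔ u ≤ φ r := by
  obtain ⟨t, ht, rfl⟩ := hbij.surjOn (Set.mem_Ici.2 hu)
  rw [hinv t ht]
  exact ((hmono.strictMonoOn_of_injOn hbij.injOn).le_iff_le ht hr).symm

/-- For a convex bijection `φ` of `[0,∞)` the set
`{x ∈ S : p_φ(x) ≤ r}` is convex in the space `S` of integrable simple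
functions, where `p_φ(x) = φ⁻¹(∫ φ(|x|) dμ)`. -/
theorem ball_pphi_convex {Ω : Type*} [MeasurableSpace Ω] (μ : Measure Ω)
    (φ φinv : ℝ → ℝ)
    (hbij : Set.BijOn φ (Set.Ici 0) (Set.Ici 0))
    (hconv : ConvexOn ℝ (Set.Ici 0) φ)
    (hmono : MonotoneOn φ (Set.Ici 0))
    (hφ0 : φ 0 = 0)
    (hinv1 : ∀ t : ℝ, 0 ≤ t → φinv (φ t) = t)
    (hinv2 : ∀ u : ℝ, 0 ≤ u → φ (φinv u) = u)
    (r : ℝ) (hr : 0 < r) :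
    ∀ x y : Ω → ℝ, IsIntegrableSimpleFunc μ x → IsIntegrableSimpleFunc μ y →
      φinv (∫ ω, φ |x ω| ∂μ) ≤ r → φinv (∫ ω, φ |y ω| ∂μ) ≤ r →
      ∀ l : ℝ, l ∈ Set.Ioo (0 : ℝ) 1 →
        φinv (∫ ω, φ |l * x ω + (1 - l) * y ω| ∂μ) ≤ r := by
  intro x y hx hy hxr hyr l ⟨hl0, hl1⟩
  have hl1' : 0 ≤ 1 - l := by linarith
  have hφ_abs : φ |0| = 0 := by rw [abs_zero, hφ0]
  have hnonneg : ∀ z : Ω → ℝ, 0 ≤ ∫ ω, φ |z ω| ∂μ := fun z =>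
    integral_nonneg fun ω => hbij.mapsTo (Set.mem_Ici.2 (abs_nonneg (z ω)))
  have hiff : ∀ z : Ω → ℝ, φinv (∫ ω, φ |z ω| ∂μ) ≤ r ↔ ∫ ω, φ |z ω| ∂μ ≤ φ r := fun z =>
    le_iff_of_monotoneOn_bijOn_Ici hbij hmono hinv1 (hnonneg z) hr.le
  have hxi : Integrable (fun ω => φ |x ω|) μ := hx.integrable_comp (g := fun t => φ |t|) hφ_abs
  have hyi : Integrable (fun ω => φ |y ω|) μ := hy.integrable_comp (g := fun t => φ |t|) hφ_abs
  have hzi : Integrable (fun ω => φ |l * x ω + (1 - l) * y ω|) μ :=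
    (hx.linear_comb hy l (1 - l)).integrable_comp (g := fun t => φ |t|) hφ_abs
  have hpt : ∀ ω, φ |l * x ω + (1 - l) * y ω| ≤ l * φ |x ω| + (1 - l) * φ |y ω| := by
    intro ω
    have habs : |l * x ω + (1 - l) * y ω| ≤ l * |x ω| + (1 - l) * |y ω| := by
      simpa [abs_mul, abs_of_pos hl0, abs_of_nonneg hl1'] using
        abs_add_le (l * x ω) ((1 - l) * y ω)
    calc φ |l * x ω + (1 - l) * y ω| ≤ φ (l * |x ω| + (1 - l) * |y ω|) :=
          hmono (Set.mem_Ici.2 (abs_nonneg _)) (Set.mem_Ici.2 (by positivity)) habs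
      _ ≤ l * φ |x ω| + (1 - l) * φ |y ω| :=
          hconv.2 (Set.mem_Ici.2 (abs_nonneg (x ω))) (Set.mem_Ici.2 (abs_nonneg (y ω)))
            hl0.le hl1' (by ring)
  refine (hiff fun ω => l * x ω + (1 - l) * y ω).2 ?_
  calc ∫ ω, φ |l * x ω + (1 - l) * y ω| ∂μ
      ≤ ∫ ω, (l * φ |x ω| + (1 - l) * φ |y ω|) ∂μ :=
        integral_mono hzi ((hxi.const_mul l).add (hyi.const_mul (1 - l))) hpt
    _ = l * ∫ ω, φ |x ω| ∂μ + (1 - l) * ∫ ω, φ |y ω| ∂μ := by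
        rw [integral_add (hxi.const_mul l) (hyi.const_mul (1 - l)), integral_const_mul,
          integral_const_mul]
    _ ≤ l * φ r + (1 - l) * φ r := by
        gcongr
        · exact (hiff x).1 hxr
        · exact (hiff y).1 hyr
    _ = φ r := by ring
end

section
/- Let φ : [0,∞) → [0,∞) be a twice differentiable bijection of [0,∞) onto itself with φ(0) = 0, φ'(r) > 0 and φ''(r) > 0 for all r > 0. If the function φ'/φ'' is superadditive on (0,∞), i.e. φ'(r+s)/φ''(r+s) ≥ φ'(r)/φ''(r) + φ'(s)/φ''(s) for all r, s > 0, then the function G : [0,∞)² → [0,∞) defined by G(r, s) = φ(|φ⁻¹(r) − φ⁻¹(s)|) is convex. -/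
open Set

/-- Two-term form of Titu's lemma, weakened in the denominator on the left. -/
lemma sq_div_le_sub_sq_div_add_sq_div {F g k : ℝ} (hF : 0 < F) (hg : 0 < g) (h : F + g ≤ k)
    (a b : ℝ) : a ^ 2 / k ≤ (a - b) ^ 2 / F + b ^ 2 / g := by
  calc a ^ 2 / k ≤ a ^ 2 / (F + g) := by gcongr
    _ ≤ (a - b) ^ 2 / F + b ^ 2 / g := by
      rw [div_add_div _ _ hF.ne' hg.ne', div_le_div_iff₀ (by positivity) (by positivity)]
      nlinarith [sq_nonneg ((a - b) * g - b * F)]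

lemma quadraticForm_nonneg_of_div_add_div_le {D E P Q R S : ℝ} (hD : 0 < D) (hE : 0 < E)
    (hR : 0 < R) (hS : 0 < S) (h : D / E + R / S ≤ P / Q) (a b : ℝ) :
    0 ≤ E * (a - b) ^ 2 + D * (b ^ 2 * S / R - a ^ 2 * Q / P) := by
  have key := sq_div_le_sub_sq_div_add_sq_div (div_pos hD hE) (div_pos hR hS) h a b
  rw [div_div_eq_mul_div, div_div_eq_mul_div, div_div_eq_mul_div] at key
  have hmul := mul_le_mul_of_nonneg_left key hD.le
  have hcancel : D * ((a - b) ^ 2 * E / D) = E * (a - b) ^ 2 := by field_simp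
  linarith [mul_add D ((a - b) ^ 2 * E / D) (b ^ 2 * S / R),
    mul_sub D (b ^ 2 * S / R) (a ^ 2 * Q / P)]

/-- A strictly increasing bijection of `[0, ∞)` has a strictly increasing continuous
inverse. -/
lemma strictMonoOn_and_continuousOn_inverse_Ici {φ φinv : ℝ → ℝ} (hmono : StrictMonoOn φ (Ici 0))
    (hmaps : MapsTo φ (Ici 0) (Ici 0)) (hmaps' : MapsTo φinv (Ici 0) (Ici 0))
    (hleft : LeftInvOn φinv φ (Ici 0)) (hright : RightInvOn φinv φ (Ici 0)) :
    StrictMonoOn φinv (Ici 0) ∧ ContinuousOn φinv (Ici 0) := by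
  have hinv : StrictMonoOn φinv (Ici 0) := fun u hu v hv huv => by
    rwa [← hmono.lt_iff_lt (hmaps' hu) (hmaps' hv), hright hu, hright hv]
  refine ⟨hinv, ?_⟩
  have hzero : φinv 0 = 0 := by
    refine le_antisymm ?_ (hmaps' self_mem_Ici)
    have := hinv.monotoneOn self_mem_Ici (hmaps self_mem_Ici) (hmaps self_mem_Ici)
    rwa [hleft self_mem_Ici] at this
  have hg : Continuous fun u => φinv (max u 0) + min u 0 := by
    refine Monotone.continuous_of_surjective (fun u v huv => ?_) fun y => ?_
    · exact add_le_add (hinv.monotoneOn (le_max_right u 0) (le_max_right v 0)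
        (max_le_max_right 0 huv)) (min_le_min_right 0 huv)
    · rcases le_total 0 y with hy | hy
      · have hφy : 0 ≤ φ y := hmaps hy
        exact ⟨φ y, by simp [hφy, hleft (mem_Ici.2 hy)]⟩
      · exact ⟨y, by simp [hy, hzero]⟩
  refine hg.continuousOn.congr fun u hu => ?_
  simp [mem_Ici.1 hu]

/-- The function `t ↦ φ (φ⁻¹ (r + t u) - φ⁻¹ (s + t v))` is convex as long as its arguments stay in
the region `r ≥ s ≥ 0`, with strict inequalities in the interior. -/
lemma convexOn_comp_sub_inverse_line {φ φinv φ' φ'' : ℝ → ℝ}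
    (hcont : ContinuousOn φ (Ici 0)) (hinv_mono : StrictMonoOn φinv (Ici 0))
    (hinv_cont : ContinuousOn φinv (Ici 0))
    (hmaps : MapsTo φinv (Ici 0) (Ici 0)) (hright : RightInvOn φinv φ (Ici 0))
    (hd1 : ∀ t, 0 < t → HasDerivAt φ (φ' t) t) (hd2 : ∀ t, 0 < t → HasDerivAt φ' (φ'' t) t)
    (hpos1 : ∀ r, 0 < r → 0 < φ' r) (hpos2 : ∀ r, 0 < r → 0 < φ'' r)
    (hsuper : ∀ r s, 0 < r → 0 < s → φ' r / φ'' r + φ' s / φ'' s ≤ φ' (r + s) / φ'' (r + s))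
    {D : Set ℝ} (hD : Convex ℝ D) (r u s v : ℝ)
    (hs : ∀ t ∈ D, 0 ≤ s + t * v) (hsr : ∀ t ∈ D, s + t * v ≤ r + t * u)
    (hs' : ∀ t ∈ interior D, 0 < s + t * v)
    (hsr' : ∀ t ∈ interior D, s + t * v < r + t * u) :
    ConvexOn ℝ D fun t => φ (φinv (r + t * u) - φinv (s + t * v)) := by
  have hinv_pos : ∀ w, 0 < w → 0 < φinv w := fun w hw =>
    (hmaps self_mem_Ici).trans_lt (hinv_mono self_mem_Ici hw.le hw)
  have hinv_deriv : ∀ w, 0 < w → HasDerivAt φinv (φ' (φinv w))⁻¹ w := fun w hw =>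
    (hd1 _ (hinv_pos w hw)).of_local_left_inverse (hinv_cont.continuousAt (Ici_mem_nhds hw))
      (hpos1 _ (hinv_pos w hw)).ne' (Filter.mem_of_superset (Ici_mem_nhds hw) hright)
  have hline : ∀ p q t, 0 < p + t * q →
      HasDerivAt (fun t => φinv (p + t * q)) (q / φ' (φinv (p + t * q))) t := fun p q t h => by
    refine ((hinv_deriv _ h).comp t (((hasDerivAt_id t).mul_const q).const_add p)).congr_deriv ?_
    simp [div_eq_inv_mul]
  have hspeed : ∀ p q t, 0 < p + t * q →
      HasDerivAt (fun t => q / φ' (φinv (p + t * q)))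
        (-((q / φ' (φinv (p + t * q))) ^ 2 * φ'' (φinv (p + t * q)) / φ' (φinv (p + t * q)))) t := by
    intro p q t h
    have hx := hinv_pos _ h
    have hne := (hpos1 _ hx).ne'
    refine ((hasDerivAt_const t q).div ((hd2 _ hx).comp t (hline p q t h)) hne).congr_deriv ?_
    simp only [Function.comp]
    field_simp
    ring
  have hrpos : ∀ t ∈ interior D, 0 < r + t * u := fun t ht => (hs' t ht).trans (hsr' t ht)
  have hdiff : ∀ t ∈ interior D, 0 < φinv (r + t * u) - φinv (s + t * v) := fun t ht =>
    sub_pos.2 (hinv_mono (hs' t ht).le (hrpos t ht).le (hsr' t ht))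
  refine convexOn_of_hasDerivWithinAt2_nonneg hD
    (f' := fun t => φ' (φinv (r + t * u) - φinv (s + t * v)) *
      (u / φ' (φinv (r + t * u)) - v / φ' (φinv (s + t * v))))
    (f'' := fun t => φ'' (φinv (r + t * u) - φinv (s + t * v)) *
      (u / φ' (φinv (r + t * u)) - v / φ' (φinv (s + t * v))) ^ 2 +
      φ' (φinv (r + t * u) - φinv (s + t * v)) *
      ((v / φ' (φinv (s + t * v))) ^ 2 * φ'' (φinv (s + t * v)) / φ' (φinv (s + t * v)) -
        (u / φ' (φinv (r + t * u))) ^ 2 * φ'' (φinv (r + t * u)) / φ' (φinv (r + t * u))))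
    ?_ ?_ ?_ ?_
  · refine hcont.comp ((hinv_cont.comp (by fun_prop) fun t ht => (hs t ht).trans (hsr t ht)).sub
      (hinv_cont.comp (by fun_prop) hs)) fun t ht => ?_
    exact sub_nonneg.2 (hinv_mono.monotoneOn (hs t ht) ((hs t ht).trans (hsr t ht)) (hsr t ht))
  · intro t ht
    exact ((hd1 _ (hdiff t ht)).comp t
      ((hline r u t (hrpos t ht)).sub (hline s v t (hs' t ht)))).hasDerivWithinAt
  · intro t ht
    have h1 := (hd2 _ (hdiff t ht)).comp t
      ((hline r u t (hrpos t ht)).sub (hline s v t (hs' t ht)))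
    have h2 := h1.mul ((hspeed r u t (hrpos t ht)).sub (hspeed s v t (hs' t ht)))
    refine (h2.congr_deriv ?_).hasDerivWithinAt
    simp only [Function.comp, Pi.sub_apply]
    ring
  · intro t ht
    have hy := hinv_pos _ (hs' t ht)
    refine quadraticForm_nonneg_of_div_add_div_le (hpos1 _ (hdiff t ht)) (hpos2 _ (hdiff t ht))
      (hpos1 _ hy) (hpos2 _ hy) ?_ _ _
    simpa using hsuper _ _ (hdiff t ht) hy

/-- A nonnegative affine function on `[0, 1]` either vanishes identically or is positive inside. -/
lemma affine_eq_zero_or_pos_of_nonneg {a b : ℝ} (ha : 0 ≤ a) (hb : 0 ≤ b) :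
    (a = 0 ∧ b = 0) ∨ ∀ t ∈ Ioo (0 : ℝ) 1, 0 < a + t * (b - a) := by
  rcases ha.eq_or_lt with rfl | ha
  · rcases hb.eq_or_lt with rfl | hb
    · exact .inl ⟨rfl, rfl⟩
    · exact .inr fun t ht => by simpa using mul_pos ht.1 hb
  · exact .inr fun t ht => by nlinarith [mul_pos (sub_pos.2 ht.2) ha, mul_nonneg ht.1.le hb]

lemma convexOn_comp_sub_inverse {φ φinv φ' φ'' : ℝ → ℝ}
    (hφ0 : φ 0 = 0) (hcont : ContinuousOn φ (Ici 0)) (hinv_mono : StrictMonoOn φinv (Ici 0))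
    (hinv_cont : ContinuousOn φinv (Ici 0)) (hinv0 : φinv 0 = 0)
    (hright : RightInvOn φinv φ (Ici 0))
    (hd1 : ∀ t, 0 < t → HasDerivAt φ (φ' t) t) (hd2 : ∀ t, 0 < t → HasDerivAt φ' (φ'' t) t)
    (hpos1 : ∀ r, 0 < r → 0 < φ' r) (hpos2 : ∀ r, 0 < r → 0 < φ'' r)
    (hsuper : ∀ r s, 0 < r → 0 < s → φ' r / φ'' r + φ' s / φ'' s ≤ φ' (r + s) / φ'' (r + s)) :
    ConvexOn ℝ {q : ℝ × ℝ | 0 ≤ q.2 ∧ q.2 ≤ q.1} fun q => φ (φinv q.1 - φinv q.2) := by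
  refine ⟨?_, ?_⟩
  · rintro ⟨r₁, s₁⟩ ⟨h₁, h₁'⟩ ⟨r₂, s₂⟩ ⟨h₂, h₂'⟩ α β hα hβ -
    dsimp only at h₁ h₁' h₂ h₂'
    refine ⟨?_, ?_⟩
    · simpa using by positivity
    · simpa using by gcongr
  rintro ⟨r₁, s₁⟩ ⟨h₁, h₁'⟩ ⟨r₂, s₂⟩ ⟨h₂, h₂'⟩ α β hα hβ hαβ
  dsimp only at h₁ h₁' h₂ h₂'
  obtain rfl : α = 1 - β := by linarith
  simp only [Prod.smul_mk, Prod.mk_add_mk, smul_eq_mul]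
  rcases affine_eq_zero_or_pos_of_nonneg h₁ h₂ with ⟨rfl, rfl⟩ | hs
  · have hr : 0 ≤ (1 - β) * r₁ + β * r₂ := by positivity
    simp only [mul_zero, add_zero, hinv0, sub_zero]
    rw [hright hr, hright h₁', hright h₂']
  rcases affine_eq_zero_or_pos_of_nonneg (sub_nonneg.2 h₁') (sub_nonneg.2 h₂') with ⟨e₁, e₂⟩ | hsr
  · obtain rfl : r₁ = s₁ := by linarith
    obtain rfl : r₂ = s₂ := by linarith
    simp [hφ0]
  have hmaps : MapsTo φinv (Ici 0) (Ici 0) := fun w hw => by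
    simpa [hinv0] using hinv_mono.monotoneOn self_mem_Ici hw hw
  have hconv := convexOn_comp_sub_inverse_line hcont hinv_mono hinv_cont hmaps hright hd1 hd2
    hpos1 hpos2 hsuper (convex_Icc 0 1) r₁ (r₂ - r₁) s₁ (s₂ - s₁)
    (fun t ht => by nlinarith [mul_nonneg (sub_nonneg.2 ht.2) h₁, mul_nonneg ht.1 h₂])
    (fun t ht => by
      nlinarith [mul_le_mul_of_nonneg_left h₁' (sub_nonneg.2 ht.2),
        mul_le_mul_of_nonneg_left h₂' ht.1])
    (fun t ht => hs t (by rwa [interior_Icc] at ht))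
    (fun t ht => by
      rw [interior_Icc] at ht
      linarith [hsr t ht])
  have := hconv.2 (left_mem_Icc.2 zero_le_one) (right_mem_Icc.2 zero_le_one) hα hβ hαβ
  simp only [smul_eq_mul, mul_zero, mul_one, zero_add, zero_mul, add_zero, one_mul,
    add_sub_cancel] at this
  convert this using 4 <;> ring

/-- If `φ` is a twice differentiable bijection of `[0,∞)` with
`φ(0)=0`, `φ' > 0` and `φ'' > 0` on `(0,∞)`, and `φ'/φ''` is superadditive on
`(0,∞)`, then `G(r,s) = φ(|φ⁻¹(r) − φ⁻¹(s)|)` is convex on `[0,∞)²`. -/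
theorem G_convex (φ φinv φ' φ'' : ℝ → ℝ)
    (hbij : Set.BijOn φ (Set.Ici 0) (Set.Ici 0))
    (hφ0 : φ 0 = 0)
    (hinv1 : ∀ t : ℝ, 0 ≤ t → φinv (φ t) = t)
    (hinv2 : ∀ u : ℝ, 0 ≤ u → φ (φinv u) = u)
    (hinvnn : ∀ u : ℝ, 0 ≤ u → 0 ≤ φinv u)
    (hd1 : ∀ t ∈ Set.Ici (0 : ℝ), HasDerivWithinAt φ (φ' t) (Set.Ici 0) t)
    (hd2 : ∀ t ∈ Set.Ici (0 : ℝ), HasDerivWithinAt φ' (φ'' t) (Set.Ici 0) t)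
    (hpos1 : ∀ r : ℝ, 0 < r → 0 < φ' r)
    (hpos2 : ∀ r : ℝ, 0 < r → 0 < φ'' r)
    (hsuper : ∀ r s : ℝ, 0 < r → 0 < s →
      φ' r / φ'' r + φ' s / φ'' s ≤ φ' (r + s) / φ'' (r + s)) :
    ConvexOn ℝ (Set.Ici 0 ×ˢ Set.Ici 0)
      (fun q : ℝ × ℝ => φ |φinv q.1 - φinv q.2|) := by
  have hcont : ContinuousOn φ (Ici 0) := fun t ht => (hd1 t ht).continuousWithinAt
  have hd1' : ∀ t, 0 < t → HasDerivAt φ (φ' t) t := fun t ht =>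
    (hd1 t ht.le).hasDerivAt (Ici_mem_nhds ht)
  have hd2' : ∀ t, 0 < t → HasDerivAt φ' (φ'' t) t := fun t ht =>
    (hd2 t ht.le).hasDerivAt (Ici_mem_nhds ht)
  have hmono : StrictMonoOn φ (Ici 0) :=
    strictMonoOn_of_hasDerivWithinAt_pos (convex_Ici 0) hcont
      (fun t ht => (hd1' t (by simpa using ht)).hasDerivWithinAt)
      (fun t ht => hpos1 t (by simpa using ht))
  obtain ⟨hinv_mono, hinv_cont⟩ :=
    strictMonoOn_and_continuousOn_inverse_Ici hmono hbij.mapsTo hinvnn hinv1 hinv2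
  have hinv0 : φinv 0 = 0 := by simpa [hφ0] using hinv1 0 le_rfl
  have hconv := convexOn_comp_sub_inverse hφ0 hcont hinv_mono hinv_cont hinv0 hinv2 hd1' hd2'
    hpos1 hpos2 hsuper
  have hbound : ∀ r s, 0 ≤ r → 0 ≤ s →
      φ (φinv (max r s) - φinv s) ≤ φ |φinv r - φinv s| := fun r s hr hs => by
    rcases le_total r s with h | h
    · simpa [h, hφ0] using hbij.mapsTo (mem_Ici.2 (abs_nonneg (φinv r - φinv s)))
    · rw [max_eq_left h, abs_of_nonneg (sub_nonneg.2 (hinv_mono.monotoneOn hs hr h))]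
  have hhalf : ∀ r₁ s₁ r₂ s₂ α β : ℝ, 0 ≤ r₁ → 0 ≤ s₁ → 0 ≤ r₂ → 0 ≤ s₂ → 0 ≤ α → 0 ≤ β →
      α + β = 1 → α * s₁ + β * s₂ ≤ α * r₁ + β * r₂ →
      φ |φinv (α * r₁ + β * r₂) - φinv (α * s₁ + β * s₂)| ≤
        α * φ |φinv r₁ - φinv s₁| + β * φ |φinv r₂ - φinv s₂| := by
    intro r₁ s₁ r₂ s₂ α β hr₁ hs₁ hr₂ hs₂ hα hβ hαβ hle
    have hr : 0 ≤ α * r₁ + β * r₂ := by positivity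
    have hs : 0 ≤ α * s₁ + β * s₂ := by positivity
    have hrmax : α * r₁ + β * r₂ ≤ α * max r₁ s₁ + β * max r₂ s₂ := by
      gcongr <;> exact le_max_left _ _
    have hnonneg := sub_nonneg.2 (hinv_mono.monotoneOn hs hr hle)
    have hinv_le := hinv_mono.monotoneOn hr (hr.trans hrmax) hrmax
    calc φ |φinv (α * r₁ + β * r₂) - φinv (α * s₁ + β * s₂)|
        = φ (φinv (α * r₁ + β * r₂) - φinv (α * s₁ + β * s₂)) := by rw [abs_of_nonneg hnonneg]
      _ ≤ φ (φinv (α * max r₁ s₁ + β * max r₂ s₂) - φinv (α * s₁ + β * s₂)) :=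
        hmono.monotoneOn hnonneg (hnonneg.trans (sub_le_sub_right hinv_le _))
          (sub_le_sub_right hinv_le _)
      _ ≤ α * φ (φinv (max r₁ s₁) - φinv s₁) + β * φ (φinv (max r₂ s₂) - φinv s₂) :=
        hconv.2 (x := (max r₁ s₁, s₁)) (y := (max r₂ s₂, s₂)) ⟨hs₁, le_max_right _ _⟩
          ⟨hs₂, le_max_right _ _⟩ hα hβ hαβ
      _ ≤ α * φ |φinv r₁ - φinv s₁| + β * φ |φinv r₂ - φinv s₂| := by
        gcongr
        · exact hbound r₁ s₁ hr₁ hs₁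
        · exact hbound r₂ s₂ hr₂ hs₂
  refine ⟨(convex_Ici 0).prod (convex_Ici 0), ?_⟩
  rintro ⟨r₁, s₁⟩ ⟨hr₁, hs₁⟩ ⟨r₂, s₂⟩ ⟨hr₂, hs₂⟩ α β hα hβ hαβ
  simp only [Prod.smul_mk, Prod.mk_add_mk, smul_eq_mul]
  rcases le_total (α * s₁ + β * s₂) (α * r₁ + β * r₂) with h | h
  · exact hhalf r₁ s₁ r₂ s₂ α β hr₁ hs₁ hr₂ hs₂ hα hβ hαβ h
  · have := hhalf s₁ r₁ s₂ r₂ α β hs₁ hr₁ hs₂ hr₂ hα hβ hαβ h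
    rwa [abs_sub_comm, abs_sub_comm (φinv s₁), abs_sub_comm (φinv s₂)] at this
end

section
/- For every real p ≥ 2 and all r, s ≥ 0 one has (r+s)^p + |r−s|^p ≥ 2r^p + 2s^p; that is, the power function t ↦ t^p is superquadratic for p ≥ 2. -/
/-- For `p ≥ 2` the power function `t ↦ t^p` is superquadratic:
`(r+s)^p + |r−s|^p ≥ 2r^p + 2s^p` for all `r, s ≥ 0`. -/
theorem rpow_superquadratic (p : ℝ) (hp : 2 ≤ p) :
    ∀ r s : ℝ, 0 ≤ r → 0 ≤ s →
      2 * r ^ p + 2 * s ^ p ≤ (r + s) ^ p + |r - s| ^ p := by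
  intro r s hr hs
  have hq : 1 ≤ p / 2 := by linarith
  have rpow_eq_sq_rpow : ∀ x : ℝ, 0 ≤ x → x ^ p = (x ^ 2) ^ (p / 2) := fun x hx => by
    rw [← Real.rpow_natCast_mul hx]
    congr 1
    push_cast
    ring
  rw [rpow_eq_sq_rpow r hr, rpow_eq_sq_rpow s hs, rpow_eq_sq_rpow _ (add_nonneg hr hs),
    rpow_eq_sq_rpow _ (abs_nonneg _), sq_abs]
  have hsuper : (r ^ 2) ^ (p / 2) + (s ^ 2) ^ (p / 2) ≤ (r ^ 2 + s ^ 2) ^ (p / 2) := by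
    exact_mod_cast NNReal.add_rpow_le_rpow_add ⟨r ^ 2, sq_nonneg r⟩ ⟨s ^ 2, sq_nonneg s⟩ hq
  have hconv := (convexOn_rpow hq).2 (Set.mem_Ici.2 (sq_nonneg (r + s)))
    (Set.mem_Ici.2 (sq_nonneg (r - s)))
    (by norm_num : (0 : ℝ) ≤ 1 / 2) (by norm_num : (0 : ℝ) ≤ 1 / 2) (by norm_num)
  have hmid : (1 / 2 : ℝ) • (r + s) ^ 2 + (1 / 2 : ℝ) • (r - s) ^ 2 = r ^ 2 + s ^ 2 := by
    simp only [smul_eq_mul]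
    ring
  rw [hmid] at hconv
  simp only [smul_eq_mul] at hconv
  linarith
end

section
/- For every real p with 0 < p ≤ 2 and all r, s ≥ 0 one has (r+s)^p + |r−s|^p ≤ 2r^p + 2s^p; that is, the power function t ↦ t^p is subquadratic for 0 < p ≤ 2. -/
/-- For `0 < p ≤ 2` the power function `t ↦ t^p` is subquadratic:
`(r+s)^p + |r−s|^p ≤ 2r^p + 2s^p` for all `r, s ≥ 0`. -/
theorem rpow_subquadratic (p : ℝ) (hp0 : 0 < p) (hp2 : p ≤ 2) :
    ∀ r s : ℝ, 0 ≤ r → 0 ≤ s →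
      (r + s) ^ p + |r - s| ^ p ≤ 2 * r ^ p + 2 * s ^ p := by
  intro r s hr hs
  have hq0 : 0 ≤ p / 2 := by linarith
  have hq1 : p / 2 ≤ 1 := by linarith
  have rpow_eq : ∀ x : ℝ, 0 ≤ x → x ^ p = (x ^ 2) ^ (p / 2) := fun x hx => by
    rw [← Real.rpow_natCast, ← Real.rpow_mul hx]
    congr 1
    push_cast
    ring
  have concave := (Real.concaveOn_rpow hq0 hq1).2
    (Set.mem_Ici.2 (sq_nonneg (r + s))) (Set.mem_Ici.2 (sq_nonneg |r - s|))
    (by norm_num : (0 : ℝ) ≤ 1 / 2) (by norm_num : (0 : ℝ) ≤ 1 / 2) (by norm_num)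
  have mean_eq : (1 / 2 : ℝ) * (r + s) ^ 2 + 1 / 2 * |r - s| ^ 2 = r ^ 2 + s ^ 2 := by
    rw [sq_abs]
    ring
  simp only [smul_eq_mul] at concave
  rw [mean_eq, ← rpow_eq _ (add_nonneg hr hs), ← rpow_eq _ (abs_nonneg _)] at concave
  have subadditive := Real.rpow_add_le_add_rpow (sq_nonneg r) (sq_nonneg s) hq0 hq1
  rw [← rpow_eq r hr, ← rpow_eq s hs] at subadditive
  linarith
end

section
/- Let (Ω, Σ, μ) be a measure space and let φ : [0,∞) → [0,∞) be an increasing bijection which is superquadratic. Assume that p_φ is subadditive on S, i.e. p_φ(x+y) ≤ p_φ(x) + p_φ(y) for all x, y ∈ S (so that p_φ is a paranorm on S). Then for every r > 0 and every ε ∈ (0, 2r) the number δ(r, ε) := r − φ⁻¹(φ(r) − φ(ε/2)) lies in (0, r), and for all x, y ∈ S with p_φ(x) ≤ r, p_φ(y) ≤ r and p_φ(x−y) ≥ ε one has p_φ((x+y)/2) ≤ φ⁻¹(φ(r) − φ(ε/2)) = r − δ(r, ε). In particular the paranormed space (S, p_φ) is uniformly convex with modulus of convexity δ. -/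
open MeasureTheory

/-- The functional `p_φ(x) = φ⁻¹(∫ φ(|x|) dμ)` (with `φinv` a given inverse of `φ`). -/
noncomputable def pphi {Ω : Type*} [MeasurableSpace Ω] (μ : Measure Ω)
    (φ φinv : ℝ → ℝ) (x : Ω → ℝ) : ℝ :=
  φinv (∫ ω, φ |x ω| ∂μ)

namespace IsIntegrableSimpleFunc

variable {Ω : Type*} [MeasurableSpace Ω] {μ : Measure Ω} {x y : Ω → ℝ}

theorem integrable_comp_s8 (hx : IsIntegrableSimpleFunc μ x) {g : ℝ → ℝ} (hg : g 0 = 0) :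
    Integrable (fun ω => g (x ω)) μ := by
  obtain ⟨hfin, hmeas, hint⟩ := hx
  let f : SimpleFunc Ω ℝ := ⟨x, fun a => hmeas (measurableSet_singleton a), hfin⟩
  have hf : f.FinMeasSupp μ := SimpleFunc.integrable_iff_finMeasSupp.1 (show Integrable f μ from hint)
  exact SimpleFunc.integrable_iff_finMeasSupp.2 (hf.map hg)

theorem comp (hx : IsIntegrableSimpleFunc μ x) {g : ℝ → ℝ} (hgm : Measurable g) (hg : g 0 = 0) :
    IsIntegrableSimpleFunc μ (fun ω => g (x ω)) :=
  ⟨(hx.1.image g).subset (by rintro _ ⟨ω, rfl⟩; exact ⟨x ω, ⟨ω, rfl⟩, rfl⟩),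
    hgm.comp hx.2.1, hx.integrable_comp_s8 hg⟩

theorem add (hx : IsIntegrableSimpleFunc μ x) (hy : IsIntegrableSimpleFunc μ y) :
    IsIntegrableSimpleFunc μ (x + y) :=
  ⟨(hx.1.add hy.1).subset (by rintro _ ⟨ω, rfl⟩; exact Set.add_mem_add ⟨ω, rfl⟩ ⟨ω, rfl⟩),
    hx.2.1.add hy.2.1, hx.2.2.add hy.2.2⟩

theorem half (hx : IsIntegrableSimpleFunc μ x) : IsIntegrableSimpleFunc μ (fun ω => x ω / 2) :=
  hx.comp (g := fun t => t / 2) (by fun_prop) (by simp)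

theorem sub (hx : IsIntegrableSimpleFunc μ x) (hy : IsIntegrableSimpleFunc μ y) :
    IsIntegrableSimpleFunc μ (x - y) := by
  rw [sub_eq_add_neg]
  exact hx.add (hy.comp (g := fun t => -t) measurable_neg (by simp))

end IsIntegrableSimpleFunc

/-- A superquadratic function satisfies the reversed parallelogram inequality on the real line. -/
theorem superquadratic_abs {φ : ℝ → ℝ}
    (hsq : ∀ r s : ℝ, 0 ≤ r → 0 ≤ s → 2 * φ r + 2 * φ s ≤ φ (r + s) + φ |r - s|) (a b : ℝ) :
    2 * φ |a| + 2 * φ |b| ≤ φ |a + b| + φ |a - b| := by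
  have h := hsq |a| |b| (abs_nonneg a) (abs_nonneg b)
  rcases abs_cases a with ⟨ha, ha'⟩ | ⟨ha, ha'⟩ <;> rcases abs_cases b with ⟨hb, hb'⟩ | ⟨hb, hb'⟩ <;>
    rw [ha, hb] at h ⊢
  · rwa [abs_of_nonneg (a := a + b) (by linarith)]
  · rw [sub_neg_eq_add, ← sub_eq_add_neg] at h
    rw [abs_of_nonneg (a := a - b) (by linarith)]
    linarith
  · rw [show -a - b = -(a + b) by ring, abs_neg, show -a + b = -(a - b) by ring] at h
    rw [abs_of_nonpos (a := a - b) (by linarith)]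
    linarith
  · rw [show -a - -b = -(a - b) by ring, abs_neg, show -a + -b = -(a + b) by ring] at h
    rwa [abs_of_nonpos (a := a + b) (by linarith)]

/-- If `φ` is an increasing superquadratic bijection of `[0,∞)` and
`p_φ` is subadditive on the space `S` of integrable simple functions, then
`(S, p_φ)` is uniformly convex with modulus `δ(r,ε) = r − φ⁻¹(φ(r) − φ(ε/2))`. -/
theorem uniformly_convex_superquadratic {Ω : Type*} [MeasurableSpace Ω]
    (μ : Measure Ω) (φ φinv : ℝ → ℝ)
    (hmono : StrictMonoOn φ (Set.Ici 0))
    (hbij : Set.BijOn φ (Set.Ici 0) (Set.Ici 0))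
    (hφ0 : φ 0 = 0)
    (hinv1 : ∀ t : ℝ, 0 ≤ t → φinv (φ t) = t)
    (hinv2 : ∀ u : ℝ, 0 ≤ u → φ (φinv u) = u)
    (hinvnn : ∀ u : ℝ, 0 ≤ u → 0 ≤ φinv u)
    (hsq : ∀ r s : ℝ, 0 ≤ r → 0 ≤ s → 2 * φ r + 2 * φ s ≤ φ (r + s) + φ |r - s|)
    (hsub : ∀ x y : Ω → ℝ, IsIntegrableSimpleFunc μ x → IsIntegrableSimpleFunc μ y →
      pphi μ φ φinv (x + y) ≤ pphi μ φ φinv x + pphi μ φ φinv y) :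
    ∀ r ε : ℝ, 0 < r → 0 < ε → ε < 2 * r →
      (r - φinv (φ r - φ (ε / 2)) ∈ Set.Ioo 0 r) ∧
      (∀ x y : Ω → ℝ, IsIntegrableSimpleFunc μ x → IsIntegrableSimpleFunc μ y →
        pphi μ φ φinv x ≤ r → pphi μ φ φinv y ≤ r →
        ε ≤ pphi μ φ φinv (x - y) →
        pphi μ φ φinv (fun ω => (x ω + y ω) / 2) ≤ φinv (φ r - φ (ε / 2))) := by
  have hφnn : ∀ t, 0 ≤ t → 0 ≤ φ t := fun t ht => hbij.mapsTo ht
  have hφle : ∀ {s t}, 0 ≤ s → 0 ≤ t → (φ s ≤ φ t ↔ s ≤ t) := fun hs ht => hmono.le_iff_le hs ht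
  have hφlt : ∀ {s t}, 0 ≤ s → 0 ≤ t → (φ s < φ t ↔ s < t) := fun hs ht => hmono.lt_iff_lt hs ht
  have hInn : ∀ z : Ω → ℝ, 0 ≤ ∫ ω, φ |z ω| ∂μ :=
    fun z => integral_nonneg fun ω => hφnn _ (abs_nonneg _)
  have hpnn : ∀ z, 0 ≤ pphi μ φ φinv z := fun z => hinvnn _ (hInn z)
  have hφp : ∀ z, φ (pphi μ φ φinv z) = ∫ ω, φ |z ω| ∂μ := fun z => hinv2 _ (hInn z)
  have hint : ∀ {z}, IsIntegrableSimpleFunc μ z → Integrable (fun ω => φ |z ω|) μ :=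
    fun hz => hz.integrable_comp_s8 (g := fun t => φ |t|) (by simpa using hφ0)
  intro r ε hr hε hεr
  have hε2 : 0 < ε / 2 := by positivity
  have hφε : 0 < φ (ε / 2) := hφ0 ▸ (hφlt le_rfl hε2.le).2 hε2
  have hφεr : φ (ε / 2) < φ r := (hφlt hε2.le hr.le).2 (by linarith)
  have hu : 0 ≤ φ r - φ (ε / 2) := by linarith
  refine ⟨⟨?_, ?_⟩, fun x y hx hy hxr hyr hxy => ?_⟩
  · have := (hφlt (hinvnn _ hu) hr.le).1 (by rw [hinv2 _ hu]; linarith)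
    linarith
  · have := (hφlt le_rfl (hinvnn _ hu)).1 (by rw [hinv2 _ hu, hφ0]; linarith)
    linarith
  · have hd := (hx.sub hy).half
    have hs := (hx.add hy).half
    have hhalf : ε / 2 ≤ pphi μ φ φinv (fun ω => (x - y) ω / 2) := by
      have h := hsub _ _ hd hd
      rw [show (fun ω => (x - y) ω / 2) + (fun ω => (x - y) ω / 2) = x - y from
        funext fun ω => add_halves _] at h
      linarith
    rw [← hφle hε2.le (hpnn _), hφp] at hhalf
    rw [← hφle (hpnn _) hr.le, hφp] at hxr hyr
    rw [← hφle (hpnn _) (hinvnn _ hu), hφp, hinv2 _ hu]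
    have hkey := integral_mono (((hint hs).const_mul 2).add ((hint hd).const_mul 2))
      ((hint hx).add (hint hy)) fun ω => by
        have h := superquadratic_abs hsq ((x ω + y ω) / 2) ((x ω - y ω) / 2)
        rwa [show (x ω + y ω) / 2 + (x ω - y ω) / 2 = x ω by ring,
          show (x ω + y ω) / 2 - (x ω - y ω) / 2 = y ω by ring] at h
    rw [integral_add' ((hint hs).const_mul 2) ((hint hd).const_mul 2),
      integral_add' (hint hx) (hint hy), integral_const_mul, integral_const_mul] at hkey
    simp only [Pi.add_apply] at hkey
    linarith
end

section
/- The function φ : [0,∞) → [0,∞) given by φ(t) = t³/(t+1) is superquadratic: for all r ≥ s ≥ 0, φ(r+s) + φ(r−s) ≥ 2φ(r) + 2φ(s). Indeed, for all r ≥ s ≥ 0 one has the identity φ(r+s) + φ(r−s) − 2φ(r) − 2φ(s) = 2s²[(r²−s²)(r+1) + r − s + 2r(r+1)] / [(r+1)(s+1)(r+s+1)(r−s+1)], and this quantity is nonnegative. -/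
/-- The function `φ(t) = t³/(t+1)` is superquadratic: for `r ≥ s ≥ 0`
one has the stated identity for `φ(r+s) + φ(r−s) − 2φ(r) − 2φ(s)` and this
quantity is nonnegative. -/
theorem cube_div_superquadratic :
    ∀ r s : ℝ, 0 ≤ s → s ≤ r →
      ((r + s) ^ 3 / ((r + s) + 1) + (r - s) ^ 3 / ((r - s) + 1)
          - 2 * (r ^ 3 / (r + 1)) - 2 * (s ^ 3 / (s + 1)) =
        2 * s ^ 2 * ((r ^ 2 - s ^ 2) * (r + 1) + r - s + 2 * r * (r + 1)) /
          ((r + 1) * (s + 1) * (r + s + 1) * (r - s + 1))) ∧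
      0 ≤ 2 * s ^ 2 * ((r ^ 2 - s ^ 2) * (r + 1) + r - s + 2 * r * (r + 1)) /
          ((r + 1) * (s + 1) * (r + s + 1) * (r - s + 1)) := by
  intro r s hs hsr
  have hr : 0 ≤ r := hs.trans hsr
  have hd : 0 ≤ r - s := sub_nonneg.mpr hsr
  constructor
  · have h₁ : r + 1 ≠ 0 := by positivity
    have h₂ : s + 1 ≠ 0 := by positivity
    have h₃ : r + s + 1 ≠ 0 := by positivity
    have h₄ : r - s + 1 ≠ 0 := by positivity
    field_simp
    ring
  · have hsq : 0 ≤ r ^ 2 - s ^ 2 := sub_nonneg.mpr (pow_le_pow_left₀ hs hsr 2)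
    rw [add_sub_assoc]
    positivity
end

section
/- The function φ : [0,∞) → [0,∞) given by φ(t) = t²·e^t is superquadratic: for all r, s ≥ 0, (r+s)²e^{r+s} + (r−s)²e^{|r−s|} ≥ 2r²e^r + 2s²e^s. -/
theorem sq_exp_superquadratic_of_le {r s : ℝ} (hs : 0 ≤ s) (hsr : s ≤ r) :
    2 * r ^ 2 * Real.exp r + 2 * s ^ 2 * Real.exp s ≤
      (r + s) ^ 2 * Real.exp (r + s) + (r - s) ^ 2 * Real.exp (r - s) := by
  have hcosh : 2 ≤ Real.exp s + Real.exp (-s) := by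
    have := Real.one_le_cosh s
    rw [Real.cosh_eq] at this
    linarith
  have hsinh : 0 ≤ Real.exp s - Real.exp (-s) :=
    sub_nonneg.2 (Real.exp_le_exp.2 (by linarith))
  have key : 2 * (r ^ 2 + s ^ 2) ≤
      (r + s) ^ 2 * Real.exp s + (r - s) ^ 2 * Real.exp (-s) := by
    have h₁ : 0 ≤ (r ^ 2 + s ^ 2) * (Real.exp s + Real.exp (-s) - 2) :=
      mul_nonneg (by positivity) (by linarith)
    have h₂ : 0 ≤ r * s * (Real.exp s - Real.exp (-s)) :=
      mul_nonneg (mul_nonneg (hs.trans hsr) hs) hsinh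
    linarith
  calc 2 * r ^ 2 * Real.exp r + 2 * s ^ 2 * Real.exp s
      ≤ 2 * r ^ 2 * Real.exp r + 2 * s ^ 2 * Real.exp r := by gcongr
    _ = Real.exp r * (2 * (r ^ 2 + s ^ 2)) := by ring
    _ ≤ Real.exp r * ((r + s) ^ 2 * Real.exp s + (r - s) ^ 2 * Real.exp (-s)) := by gcongr
    _ = _ := by rw [sub_eq_add_neg r s, Real.exp_add, Real.exp_add]; ring

/-- The function `φ(t) = t²·e^t` is superquadratic:
`(r+s)²e^{r+s} + (r−s)²e^{|r−s|} ≥ 2r²e^r + 2s²e^s` for all `r, s ≥ 0`. -/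
theorem sq_exp_superquadratic :
    ∀ r s : ℝ, 0 ≤ r → 0 ≤ s →
      2 * r ^ 2 * Real.exp r + 2 * s ^ 2 * Real.exp s ≤
        (r + s) ^ 2 * Real.exp (r + s) + (r - s) ^ 2 * Real.exp |r - s| := by
  intro r s hr hs
  rcases le_total s r with h | h
  · rw [abs_of_nonneg (sub_nonneg.2 h)]
    exact sq_exp_superquadratic_of_le hs h
  · rw [abs_sub_comm, abs_of_nonneg (sub_nonneg.2 h), add_comm r s, sub_sq_comm, add_comm]
    exact sq_exp_superquadratic_of_le hr h
end

section
/- For every real a > 1, the function φ(t) = a^t − 1 is geometrically convex on [0,∞), i.e. a^{√(st)} − 1 ≤ √((a^s − 1)(a^t − 1)) for all s, t ≥ 0. Likewise, for every a > 1 and p ≥ 1 the function φ(t) = t^p·a^t is geometrically convex on [0,∞): (√(st))^p · a^{√(st)} ≤ √(s^p a^s · t^p a^t) for all s, t ≥ 0. -/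
open Filter in
/-- The Cauchy–Schwarz inequality for `exp - 1`, read off from its power series. -/
theorem Real.sq_exp_sub_one_le_of_sq_eq_mul {x y z : ℝ} (hx : 0 ≤ x) (hy : 0 ≤ y)
    (h : z ^ 2 = x * y) :
    (Real.exp z - 1) ^ 2 ≤ (Real.exp x - 1) * (Real.exp y - 1) := by
  have key (w : ℝ) : Tendsto (fun N : ℕ => ∑ n ∈ Finset.range N,
      w ^ (n + 1) / ((n + 1).factorial : ℝ)) atTop (nhds (Real.exp w - 1)) := by
    have hw : HasSum (fun n : ℕ => w ^ n / (n.factorial : ℝ)) (Real.exp w) := by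
      rw [Real.exp_eq_exp_ℝ]
      exact NormedSpace.expSeries_div_hasSum_exp w
    simpa using ((hasSum_nat_add_iff' 1).mpr hw).tendsto_sum_nat
  refine le_of_tendsto_of_tendsto' ((key z).pow 2) ((key x).mul (key y)) fun N => ?_
  refine Finset.sum_sq_le_sum_mul_sum_of_sq_le_mul _ (fun n _ => by positivity)
    (fun n _ => by positivity) fun n _ => le_of_eq ?_
  rw [div_pow, ← pow_mul, mul_comm (n + 1) 2, pow_mul, h, mul_pow, div_mul_div_comm, sq]

/-- For `a > 1` the function `φ(t) = a^t − 1` is geometrically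
convex on `[0,∞)`, and for `a > 1`, `p ≥ 1` so is `φ(t) = t^p·a^t`. -/
theorem geom_convex_examples :
    (∀ a : ℝ, 1 < a → ∀ s t : ℝ, 0 ≤ s → 0 ≤ t →
      a ^ Real.sqrt (s * t) - 1 ≤ Real.sqrt ((a ^ s - 1) * (a ^ t - 1))) ∧
    (∀ a p : ℝ, 1 < a → 1 ≤ p → ∀ s t : ℝ, 0 ≤ s → 0 ≤ t →
      Real.sqrt (s * t) ^ p * a ^ Real.sqrt (s * t) ≤
        Real.sqrt (s ^ p * a ^ s * (t ^ p * a ^ t))) := by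
  constructor
  · intro a ha s t hs ht
    have ha0 : 0 < a := by linarith
    have hlog := (Real.log_pos ha).le
    apply Real.le_sqrt_of_sq_le
    simp only [Real.rpow_def_of_pos ha0]
    refine Real.sq_exp_sub_one_le_of_sq_eq_mul (by positivity) (by positivity) ?_
    rw [mul_pow, Real.sq_sqrt (by positivity)]
    ring
  · intro a p ha _ s t hs ht
    have ha0 : 0 < a := by linarith
    apply Real.le_sqrt_of_sq_le
    have hst : 0 ≤ s * t := by positivity
    have hamgm : √(s * t) + √(s * t) ≤ s + t := by
      rw [Real.sqrt_mul hs]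
      nlinarith [sq_nonneg (√s - √t), Real.sq_sqrt hs, Real.sq_sqrt ht]
    calc (√(s * t) ^ p * a ^ √(s * t)) ^ 2
        = (√(s * t) * √(s * t)) ^ p * a ^ (√(s * t) + √(s * t)) := by
          rw [Real.mul_rpow (Real.sqrt_nonneg _) (Real.sqrt_nonneg _), Real.rpow_add ha0]
          ring
      _ ≤ (s * t) ^ p * a ^ (s + t) := by
          rw [Real.mul_self_sqrt hst]
          gcongr
          exact ha.le
      _ = s ^ p * a ^ s * (t ^ p * a ^ t) := by
          rw [Real.mul_rpow hs ht, Real.rpow_add ha0]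
          ring
end

section
/- Let (Ω, Σ, μ) be a measure space, φ : [0,∞) → [0,∞) a bijection with φ(0) = 0, and define H : [0,∞)² → [0,∞) by H(r, s) = φ(φ⁻¹(r) + φ⁻¹(s)) + φ(|φ⁻¹(r) − φ⁻¹(s)|). Then the inequality φ(p_φ(x) + p_φ(y)) + φ(|p_φ(x) − p_φ(y)|) ≤ φ(p_φ(x+y)) + φ(p_φ(x−y)) holds for all x, y ∈ S if and only if for every k ∈ ℕ, all r₁,…,r_k, s₁,…,s_k ∈ [0,∞), and all pairwise disjoint sets A₁,…,A_k ∈ Σ of finite measure, writing aᵢ = μ(Aᵢ), one has H(Σᵢ aᵢrᵢ, Σᵢ aᵢsᵢ) ≤ Σᵢ aᵢ·H(rᵢ, sᵢ). -/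
open MeasureTheory

/-- The function `H(r,s) = φ(φ⁻¹(r) + φ⁻¹(s)) + φ(|φ⁻¹(r) − φ⁻¹(s)|)`. -/
noncomputable def Hfun (φ φinv : ℝ → ℝ) (r s : ℝ) : ℝ :=
  φ (φinv r + φinv s) + φ |φinv r - φinv s|

section DisjointFamily

variable {Ω ι : Type*} [Fintype ι] {A : ι → Set Ω}

/-- The step function with value `c i` on `A i`, for a finite disjoint family of sets `A`. -/
noncomputable def stepFun (A : ι → Set Ω) (c : ι → ℝ) (ω : Ω) : ℝ :=
  ∑ i, (A i).indicator (fun _ => c i) ω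

theorem stepFun_of_mem (hd : Pairwise (Function.onFun Disjoint A)) (c : ι → ℝ) {ω : Ω} {i : ι}
    (hω : ω ∈ A i) : stepFun A c ω = c i := by
  unfold stepFun
  rw [Finset.sum_eq_single i, Set.indicator_of_mem hω]
  · intro j _ hj
    exact Set.indicator_of_notMem (fun h => Set.disjoint_left.1 (hd hj) h hω) _
  · simp

theorem stepFun_of_notMem (c : ι → ℝ) {ω : Ω} (hω : ∀ i, ω ∉ A i) : stepFun A c ω = 0 :=
  Finset.sum_eq_zero fun i _ => Set.indicator_of_notMem (hω i) _

theorem eq_stepFun (hd : Pairwise (Function.onFun Disjoint A)) {c : ι → ℝ} {F : Ω → ℝ}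
    (hF : ∀ i, ∀ ω ∈ A i, F ω = c i) (hF0 : ∀ ω, (∀ i, ω ∉ A i) → F ω = 0) :
    F = stepFun A c := by
  funext ω
  by_cases h : ∃ i, ω ∈ A i
  · obtain ⟨i, hi⟩ := h
    rw [hF i ω hi, stepFun_of_mem hd c hi]
  · push Not at h
    rw [hF0 ω h, stepFun_of_notMem c h]

variable [MeasurableSpace Ω] {μ : Measure Ω}

theorem integral_stepFun (hm : ∀ i, MeasurableSet (A i)) (hfin : ∀ i, μ (A i) ≠ ⊤) (c : ι → ℝ) :
    ∫ ω, stepFun A c ω ∂μ = ∑ i, (μ (A i)).toReal * c i := by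
  unfold stepFun
  rw [integral_finsetSum]
  · refine Finset.sum_congr rfl fun i _ => ?_
    rw [integral_indicator_const _ (hm i), smul_eq_mul, Measure.real]
  · exact fun i _ => (integrable_indicator_iff (hm i)).2 (integrableOn_const (hfin i))

theorem isIntegrableSimpleFunc_stepFun (hm : ∀ i, MeasurableSet (A i))
    (hd : Pairwise (Function.onFun Disjoint A)) (hfin : ∀ i, μ (A i) ≠ ⊤) (c : ι → ℝ) :
    IsIntegrableSimpleFunc μ (stepFun A c) := by
  refine ⟨?_, ?_, ?_⟩
  · refine ((Set.finite_range c).insert 0).subset ?_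
    rintro _ ⟨ω, rfl⟩
    by_cases h : ∃ i, ω ∈ A i
    · obtain ⟨i, hi⟩ := h
      exact Or.inr ⟨i, (stepFun_of_mem hd c hi).symm⟩
    · push Not at h
      exact Or.inl (stepFun_of_notMem c h)
  · exact Finset.measurable_sum _ fun i _ => measurable_const.indicator (hm i)
  · exact integrable_finsetSum _ fun i _ =>
      (integrable_indicator_iff (hm i)).2 (integrableOn_const (hfin i))

theorem integral_comp_stepFun₂ (hm : ∀ i, MeasurableSet (A i))
    (hd : Pairwise (Function.onFun Disjoint A)) (hfin : ∀ i, μ (A i) ≠ ⊤) (c d : ι → ℝ)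
    {g : ℝ → ℝ → ℝ} (hg : g 0 0 = 0) :
    ∫ ω, g (stepFun A c ω) (stepFun A d ω) ∂μ = ∑ i, (μ (A i)).toReal * g (c i) (d i) := by
  rw [← integral_stepFun hm hfin]
  refine congrArg (integral μ) (eq_stepFun hd (fun i ω hi => ?_) fun ω h => ?_)
  · rw [stepFun_of_mem hd c hi, stepFun_of_mem hd d hi]
  · rw [stepFun_of_notMem c h, stepFun_of_notMem d h, hg]

end DisjointFamily

/-- Two integrable simple functions are step functions over a common finite disjoint family of
measurable sets of finite measure. -/
theorem exists_stepFun_eq {Ω : Type*} [MeasurableSpace Ω] {μ : Measure Ω} {x y : Ω → ℝ}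
    (hx : IsIntegrableSimpleFunc μ x) (hy : IsIntegrableSimpleFunc μ y) :
    ∃ (k : ℕ) (A : Fin k → Set Ω) (c d : Fin k → ℝ), (∀ i, MeasurableSet (A i)) ∧
      Pairwise (Function.onFun Disjoint A) ∧ (∀ i, μ (A i) ≠ ⊤) ∧
      x = stepFun A c ∧ y = stepFun A d := by
  have hT : ((Set.range x ×ˢ Set.range y) \ {((0 : ℝ), (0 : ℝ))}).Finite :=
    (hx.1.prod hy.1).sdiff
  obtain ⟨k, v, hv, hvT⟩ := hT.fin_param
  have hd : Pairwise (Function.onFun Disjoint fun i => {ω | (x ω, y ω) = v i}) := by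
    intro i j hij
    refine Set.disjoint_left.2 fun ω hi hj => hij (hv ?_)
    exact Eq.trans (Eq.symm hi) hj
  have hoff : ∀ ω, (∀ i, ω ∉ {ω | (x ω, y ω) = v i}) → x ω = 0 ∧ y ω = 0 := by
    intro ω h
    by_contra hne
    have : (x ω, y ω) ∈ Set.range v := by
      rw [hvT]
      exact ⟨⟨⟨ω, rfl⟩, ⟨ω, rfl⟩⟩, fun h0 => hne (Prod.mk.inj h0)⟩
    obtain ⟨i, hi⟩ := this
    exact h i hi.symm
  refine ⟨k, fun i => {ω | (x ω, y ω) = v i}, fun i => (v i).1, fun i => (v i).2,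
    fun i => ?_, hd, fun i => ?_, ?_, ?_⟩
  · exact (hx.2.1.prodMk hy.2.1) (measurableSet_singleton (v i))
  · have hne : v i ≠ (0, 0) := by
      have : v i ∈ Set.range v := ⟨i, rfl⟩
      rw [hvT] at this
      exact this.2
    have key : ∀ {z : Ω → ℝ} {a : ℝ}, Integrable z μ → a ≠ 0 →
        (∀ ω ∈ {ω | (x ω, y ω) = v i}, z ω = a) → μ {ω | (x ω, y ω) = v i} ≠ ⊤ := by
      intro z a hz ha h
      refine ((measure_mono fun ω hω => ?_).trans_lt
        (hz.measure_norm_ge_lt_top (norm_pos_iff.2 ha))).ne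
      exact (congrArg norm (h ω hω)).ge
    by_cases h1 : (v i).1 = 0
    · exact key hy.2.2 (fun h2 => hne (Prod.ext h1 h2)) fun ω hω => congrArg Prod.snd hω
    · exact key hx.2.2 h1 fun ω hω => congrArg Prod.fst hω
  · exact eq_stepFun hd (fun i ω hω => congrArg Prod.fst hω) fun ω h => (hoff ω h).1
  · exact eq_stepFun hd (fun i ω hω => congrArg Prod.snd hω) fun ω h => (hoff ω h).2

theorem apply_abs_add_abs_add_apply_abs_sub_abs (φ : ℝ → ℝ) (a b : ℝ) :
    φ (|a| + |b|) + φ |(|a| - |b|)| = φ |a + b| + φ |a - b| := by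
  rcases abs_cases a with ⟨ha, ha'⟩ | ⟨ha, ha'⟩ <;> rcases abs_cases b with ⟨hb, hb'⟩ | ⟨hb, hb'⟩
  · rw [ha, hb, abs_of_nonneg (add_nonneg ha' hb')]
  · rw [ha, hb, sub_neg_eq_add, ← sub_eq_add_neg, abs_of_nonneg (by linarith : 0 ≤ a - b),
      add_comm]
  · rw [ha, hb, abs_of_nonpos (by linarith : a - b ≤ 0), add_comm, ← abs_neg (a + b)]
    congr 3 <;> ring
  · rw [ha, hb, abs_of_nonpos (by linarith : a + b ≤ 0), ← abs_neg (a - b)]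
    congr 2 <;> ring_nf

/-- For step functions, the inequality for `p_φ` is the inequality for `H`. -/
theorem pphi_ineq_stepFun_iff {Ω ι : Type*} [Fintype ι] [MeasurableSpace Ω] {μ : Measure Ω}
    {φ φinv : ℝ → ℝ} (hφ : ∀ t, 0 ≤ t → 0 ≤ φ t) (hφ0 : φ 0 = 0)
    (hinv1 : ∀ t : ℝ, 0 ≤ t → φinv (φ t) = t) (hinv2 : ∀ u : ℝ, 0 ≤ u → φ (φinv u) = u)
    {A : ι → Set Ω} (hm : ∀ i, MeasurableSet (A i)) (hd : Pairwise (Function.onFun Disjoint A))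
    (hfin : ∀ i, μ (A i) ≠ ⊤) (c d : ι → ℝ) :
    φ (pphi μ φ φinv (stepFun A c) + pphi μ φ φinv (stepFun A d)) +
          φ |pphi μ φ φinv (stepFun A c) - pphi μ φ φinv (stepFun A d)| ≤
        φ (pphi μ φ φinv (stepFun A c + stepFun A d)) +
          φ (pphi μ φ φinv (stepFun A c - stepFun A d)) ↔
      Hfun φ φinv (∑ i, (μ (A i)).toReal * φ |c i|) (∑ i, (μ (A i)).toReal * φ |d i|) ≤
        ∑ i, (μ (A i)).toReal * Hfun φ φinv (φ |c i|) (φ |d i|) := by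
  have hpphi : ∀ z : Ω → ℝ, φ (pphi μ φ φinv z) = ∫ ω, φ |z ω| ∂μ := fun z =>
    hinv2 _ (integral_nonneg fun ω => hφ _ (abs_nonneg _))
  have hcomp := fun g : ℝ → ℝ → ℝ => integral_comp_stepFun₂ (g := g) hm hd hfin c d
  have hH : ∀ i, Hfun φ φinv (φ |c i|) (φ |d i|) = φ |c i + d i| + φ |c i - d i| := by
    intro i
    rw [Hfun, hinv1 _ (abs_nonneg _), hinv1 _ (abs_nonneg _),
      apply_abs_add_abs_add_apply_abs_sub_abs]
  rw [hpphi, hpphi, Finset.sum_congr rfl fun i _ => congrArg _ (hH i)]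
  simp only [pphi, Hfun, Pi.add_apply, Pi.sub_apply, mul_add, Finset.sum_add_distrib]
  rw [hcomp (fun a _ => φ |a|) (by simp [hφ0]), hcomp (fun _ b => φ |b|) (by simp [hφ0]),
    hcomp (fun a b => φ |a + b|) (by simp [hφ0]), hcomp (fun a b => φ |a - b|) (by simp [hφ0])]

/-- The inequality
`φ(p_φ(x) + p_φ(y)) + φ(|p_φ(x) − p_φ(y)|) ≤ φ(p_φ(x+y)) + φ(p_φ(x−y))` holds for
all integrable simple `x, y` iff `H` satisfies the Jensen-type condition
`H(Σ aᵢrᵢ, Σ aᵢsᵢ) ≤ Σ aᵢ H(rᵢ, sᵢ)` for all `aᵢ = μ(Aᵢ)` with `Aᵢ` pairwise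
disjoint measurable sets of finite measure. -/
theorem pphi_ineq_iff_H_condition {Ω : Type*} [MeasurableSpace Ω]
    (μ : Measure Ω) (φ φinv : ℝ → ℝ)
    (hbij : Set.BijOn φ (Set.Ici 0) (Set.Ici 0))
    (hφ0 : φ 0 = 0)
    (hinv1 : ∀ t : ℝ, 0 ≤ t → φinv (φ t) = t)
    (hinv2 : ∀ u : ℝ, 0 ≤ u → φ (φinv u) = u) :
    (∀ x y : Ω → ℝ, IsIntegrableSimpleFunc μ x → IsIntegrableSimpleFunc μ y →
      φ (pphi μ φ φinv x + pphi μ φ φinv y) +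
          φ |pphi μ φ φinv x - pphi μ φ φinv y| ≤
        φ (pphi μ φ φinv (x + y)) + φ (pphi μ φ φinv (x - y))) ↔
    (∀ (k : ℕ) (r s : Fin k → ℝ) (A : Fin k → Set Ω),
      (∀ i, 0 ≤ r i) → (∀ i, 0 ≤ s i) →
      (∀ i, MeasurableSet (A i)) → Pairwise (Function.onFun Disjoint A) →
      (∀ i, μ (A i) ≠ ⊤) →
      Hfun φ φinv (∑ i, (μ (A i)).toReal * r i) (∑ i, (μ (A i)).toReal * s i) ≤
        ∑ i, (μ (A i)).toReal * Hfun φ φinv (r i) (s i)) := by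
  have hφ : ∀ t, 0 ≤ t → 0 ≤ φ t := fun t ht => hbij.mapsTo ht
  have hφinv : ∀ u, 0 ≤ u → 0 ≤ φinv u := by
    intro u hu
    obtain ⟨t, ht, rfl⟩ := hbij.surjOn hu
    rwa [hinv1 t ht]
  constructor
  · intro h k r s A hr hs hm hd hfin
    have hφabs : ∀ u, 0 ≤ u → φ |φinv u| = u := fun u hu => by
      rw [abs_of_nonneg (hφinv u hu), hinv2 u hu]
    have key := (pphi_ineq_stepFun_iff hφ hφ0 hinv1 hinv2 hm hd hfin
      (fun i => φinv (r i)) (fun i => φinv (s i))).1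
      (h _ _ (isIntegrableSimpleFunc_stepFun hm hd hfin _)
        (isIntegrableSimpleFunc_stepFun hm hd hfin _))
    simpa only [hφabs _ (hr _), hφabs _ (hs _)] using key
  · intro h x y hx hy
    obtain ⟨k, A, c, d, hm, hd, hfin, rfl, rfl⟩ := exists_stepFun_eq hx hy
    exact (pphi_ineq_stepFun_iff hφ hφ0 hinv1 hinv2 hm hd hfin c d).2
      (h k _ _ A (fun i => hφ _ (abs_nonneg _)) (fun i => hφ _ (abs_nonneg _)) hm hd hfin)
end

section
/- Let (Ω, Σ, μ) be a measure space and let φ : [0,∞) → [0,∞) be an increasing, strictly convex bijection such that p_φ is subadditive on S (so that p_φ is a paranorm). Define H(r, s) = φ(φ⁻¹(r) + φ⁻¹(s)) + φ(|φ⁻¹(r) − φ⁻¹(s)|) and assume that H(Σᵢ aᵢrᵢ, Σᵢ aᵢsᵢ) ≤ Σᵢ aᵢ·H(rᵢ, sᵢ) for every k ∈ ℕ, all rᵢ, sᵢ ∈ [0,∞) and all aᵢ = μ(Aᵢ) with A₁,…,A_k ∈ Σ pairwise disjoint of finite measure. Then for every r > 0 and ε ∈ (0, 2r) there exists a unique δ(r,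 ε) ∈ (0, r) satisfying φ(r − δ(r,ε) + ε/2) + φ(|r − δ(r,ε) − ε/2|) = 2φ(r), and for all x, y ∈ S with p_φ(x) ≤ r, p_φ(y) ≤ r and p_φ(x−y) ≥ ε one has p_φ((x+y)/2) ≤ r − δ(r, ε). In particular (S, p_φ) is uniformly convex. -/
open MeasureTheory

section Helpers

/-- The even extension of a strictly increasing strictly convex function on `[0,∞)` is strictly
convex on the line. -/
theorem strictConvexOn_comp_abs {φ : ℝ → ℝ} (hmono : StrictMonoOn φ (Set.Ici 0))
    (hconv : StrictConvexOn ℝ (Set.Ici 0) φ) :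
    StrictConvexOn ℝ Set.univ (fun t => φ |t|) := by
  refine ⟨convex_univ, fun x _ y _ hxy a b ha hb hab => ?_⟩
  simp only [smul_eq_mul]
  have hle : |a * x + b * y| ≤ a * |x| + b * |y| := by
    simpa [abs_mul, abs_of_pos ha, abs_of_pos hb] using abs_add_le (a * x) (b * y)
  have hnn : (0 : ℝ) ≤ a * |x| + b * |y| := by positivity
  by_cases h : |x| = |y|
  · have hx : x = -y := (abs_eq_abs.mp h).resolve_left hxy
    have hy : 0 < |y| := abs_pos.mpr fun h0 => hxy (by simp [hx, h0])
    have hlt : |a * x + b * y| < |y| := by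
      have hrw : a * x + b * y = (b - a) * y := by rw [hx]; ring
      rw [hrw, abs_mul]
      have : |b - a| < 1 := abs_lt.mpr ⟨by linarith, by linarith⟩
      nlinarith
    have := hmono (Set.mem_Ici.mpr (abs_nonneg _)) (Set.mem_Ici.mpr (abs_nonneg y)) hlt
    rw [h, ← add_mul, hab, one_mul]
    exact this
  · exact (hmono.monotoneOn (Set.mem_Ici.mpr (abs_nonneg _)) hnn hle).trans_lt
      (hconv.2 (abs_nonneg x) (abs_nonneg y) h ha hb hab)

/-- For an even strictly convex `ψ`, the map `u ↦ ψ (u + v) + ψ (u - v)` is strictly increasing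
on `[0,∞)`. -/
theorem StrictConvexOn.strictMonoOn_add_add_sub {ψ : ℝ → ℝ} (hψ : StrictConvexOn ℝ Set.univ ψ)
    (heven : ∀ t, ψ (-t) = ψ t) (v : ℝ) :
    StrictMonoOn (fun u => ψ (u + v) + ψ (u - v)) (Set.Ici 0) := by
  intro u hu w _ huw
  have hu : 0 ≤ u := hu
  have hw : 0 < w := hu.trans_lt huw
  have hθ : u / w < 1 := (div_lt_one hw).mpr huw
  have hθ0 : 0 ≤ u / w := by positivity
  have hne : w + v ≠ -(w - v) := fun h => by linarith
  have hne' : -(w + v) ≠ w - v := fun h => by linarith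
  have hmul : u / w * w = u := div_mul_cancel₀ u hw.ne'
  have h1 := hψ.2 (Set.mem_univ (w + v)) (Set.mem_univ (-(w - v))) hne
    (show 0 < (1 + u / w) / 2 by linarith) (show 0 < (1 - u / w) / 2 by linarith) (by ring)
  have h2 := hψ.2 (Set.mem_univ (-(w + v))) (Set.mem_univ (w - v)) hne'
    (show 0 < (1 - u / w) / 2 by linarith) (show 0 < (1 + u / w) / 2 by linarith) (by ring)
  simp only [smul_eq_mul, heven] at h1 h2
  rw [show (1 + u / w) / 2 * (w + v) + (1 - u / w) / 2 * -(w - v) = u + v by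
    linear_combination hmul] at h1
  rw [show (1 - u / w) / 2 * -(w + v) + (1 + u / w) / 2 * (w - v) = u - v by
    linear_combination hmul] at h2
  change ψ (u + v) + ψ (u - v) < ψ (w + v) + ψ (w - v)
  linarith

theorem apply_abs_half_add_add_sub {φ : ℝ → ℝ} (a b : ℝ) :
    φ (|(a + b) / 2| + |(a - b) / 2|) + φ |(|(a + b) / 2| - |(a - b) / 2|)| =
      φ |a| + φ |b| := by
  have key : (|(a + b) / 2| + |(a - b) / 2| = |a| ∧ |(|(a + b) / 2| - |(a - b) / 2|)| = |b|) ∨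
      (|(a + b) / 2| + |(a - b) / 2| = |b| ∧ |(|(a + b) / 2| - |(a - b) / 2|)| = |a|) := by
    rcases abs_cases ((a + b) / 2) with ⟨h1, _⟩ | ⟨h1, _⟩ <;>
    rcases abs_cases ((a - b) / 2) with ⟨h2, _⟩ | ⟨h2, _⟩ <;> rw [h1, h2]
    · left
      rw [show (a + b) / 2 - (a - b) / 2 = b by ring]
      exact ⟨by rw [abs_of_nonneg (by linarith)]; ring, rfl⟩
    · right
      rw [show (a + b) / 2 - -((a - b) / 2) = a by ring]
      exact ⟨by rw [abs_of_nonneg (by linarith)]; ring, rfl⟩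
    · right
      rw [show -((a + b) / 2) - (a - b) / 2 = -a by ring, abs_neg]
      exact ⟨by rw [abs_of_nonpos (by linarith)]; ring, rfl⟩
    · left
      rw [show -((a + b) / 2) - -((a - b) / 2) = -b by ring, abs_neg]
      exact ⟨by rw [abs_of_nonpos (by linarith)]; ring, rfl⟩
  rcases key with ⟨h1, h2⟩ | ⟨h1, h2⟩ <;> rw [h1, h2]
  exact add_comm _ _

variable {Ω : Type*} [MeasurableSpace Ω] {μ : Measure Ω}

theorem IsIntegrableSimpleFunc.half_sub {x y : Ω → ℝ} (hx : IsIntegrableSimpleFunc μ x)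
    (hy : IsIntegrableSimpleFunc μ y) :
    IsIntegrableSimpleFunc μ (fun ω => (x ω - y ω) / 2) := by
  refine ⟨(hx.1.image2 (fun a b => (a - b) / 2) hy.1).subset ?_,
    (hx.2.1.sub hy.2.1).div_const 2, (hx.2.2.sub hy.2.2).div_const 2⟩
  rintro _ ⟨ω, rfl⟩
  exact ⟨x ω, ⟨ω, rfl⟩, y ω, ⟨ω, rfl⟩, rfl⟩

theorem measure_preimage_singleton_ne_top_of_integrable {x : Ω → ℝ} (hx : Integrable x μ) {c : ℝ}
    (hc : c ≠ 0) : μ (x ⁻¹' {c}) ≠ ⊤ := by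
  refine ((measure_mono ?_).trans_lt
    (hx.measure_norm_ge_lt_top (norm_pos_iff.mpr hc))).ne
  rintro ω rfl
  exact le_refl ‖x ω‖

/-- Two integrable simple functions have a common finite family of level sets of finite measure,
which computes the integral of any function of them that vanishes at the origin. -/
theorem IsIntegrableSimpleFunc.exists_common_levels {x y : Ω → ℝ}
    (hx : IsIntegrableSimpleFunc μ x) (hy : IsIntegrableSimpleFunc μ y) :
    ∃ (k : ℕ) (c : Fin k → ℝ × ℝ) (A : Fin k → Set Ω),
      (∀ i, MeasurableSet (A i)) ∧ Pairwise (Function.onFun Disjoint A) ∧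
      (∀ i, μ (A i) ≠ ⊤) ∧
      ∀ f : ℝ → ℝ → ℝ, f 0 0 = 0 →
        ∫ ω, f (x ω) (y ω) ∂μ = ∑ i, (μ (A i)).toReal * f (c i).1 (c i).2 := by
  classical
  have hfin : (Set.range x ×ˢ Set.range y).Finite := hx.1.prod hy.1
  set F : Finset (ℝ × ℝ) := hfin.toFinset.erase 0 with hF
  set B : ℝ × ℝ → Set Ω := fun c => (fun ω => (x ω, y ω)) ⁻¹' {c} with hB
  have hBm : ∀ c, MeasurableSet (B c) := fun c =>
    (hx.2.1.prodMk hy.2.1) (measurableSet_singleton c)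
  have hBfin : ∀ c ∈ F, μ (B c) ≠ ⊤ := by
    intro c hc
    have hc0 : c ≠ 0 := Finset.ne_of_mem_erase hc
    by_cases h1 : c.1 = 0
    · have h2 : c.2 ≠ 0 := fun h2 => hc0 (Prod.ext h1 h2)
      refine measure_ne_top_of_subset ?_
        (measure_preimage_singleton_ne_top_of_integrable hy.2.2 h2)
      rintro ω rfl
      rfl
    · refine measure_ne_top_of_subset ?_
        (measure_preimage_singleton_ne_top_of_integrable hx.2.2 h1)
      rintro ω rfl
      rfl
  refine ⟨F.card, fun i => (F.equivFin.symm i : ℝ × ℝ), fun i => B (F.equivFin.symm i),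
    fun i => hBm _, ?_, fun i => hBfin _ (F.equivFin.symm i).2, ?_⟩
  · intro i j hij
    refine Disjoint.preimage _ (Set.disjoint_singleton.mpr fun h => hij ?_)
    exact F.equivFin.symm.injective (Subtype.ext h)
  · intro f hf
    have hpt : ∀ ω, f (x ω) (y ω) = ∑ c ∈ F, (B c).indicator (fun _ => f c.1 c.2) ω := by
      intro ω
      have hind : ∀ c, (B c).indicator (fun _ => f c.1 c.2) ω =
          if (x ω, y ω) = c then f c.1 c.2 else 0 := fun c => by
        simp [hB, Set.indicator_apply]
      simp only [hind, Finset.sum_ite_eq]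
      split_ifs with h
      · rfl
      · have h0 : (x ω, y ω) = (0 : ℝ × ℝ) := by
          by_contra h0
          exact h (Finset.mem_erase.mpr ⟨h0, by simp⟩)
        rw [Prod.mk_eq_zero] at h0
        rw [h0.1, h0.2, hf]
    simp only [hpt]
    rw [integral_finsetSum _ fun c hc =>
      (integrable_indicator_iff (hBm c)).mpr (integrableOn_const (hBfin c hc))]
    simp only [integral_indicator_const _ (hBm _), smul_eq_mul]
    rw [← Finset.sum_coe_sort F]
    exact (Equiv.sum_comp F.equivFin.symm
      fun c : F => (μ (B c)).toReal * f (c : ℝ × ℝ).1 (c : ℝ × ℝ).2).symm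

end Helpers

/-- If `φ` is an increasing strictly convex bijection of `[0,∞)`,
`p_φ` is subadditive on `S`, and `H` satisfies the Jensen-type condition, then
for all `r > 0`, `ε ∈ (0,2r)` there is a unique `δ(r,ε) ∈ (0,r)` with
`φ(r − δ + ε/2) + φ(|r − δ − ε/2|) = 2φ(r)`, and `p_φ(x) ≤ r`, `p_φ(y) ≤ r`,
`p_φ(x−y) ≥ ε` imply `p_φ((x+y)/2) ≤ r − δ`; so `(S, p_φ)` is uniformly convex. -/
theorem uniformly_convex_of_H_condition {Ω : Type*} [MeasurableSpace Ω]
    (μ : Measure Ω) (φ φinv : ℝ → ℝ)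
    (hmono : StrictMonoOn φ (Set.Ici 0))
    (hbij : Set.BijOn φ (Set.Ici 0) (Set.Ici 0))
    (hφ0 : φ 0 = 0)
    (hconv : StrictConvexOn ℝ (Set.Ici 0) φ)
    (hinv1 : ∀ t : ℝ, 0 ≤ t → φinv (φ t) = t)
    (hinv2 : ∀ u : ℝ, 0 ≤ u → φ (φinv u) = u)
    (hinvnn : ∀ u : ℝ, 0 ≤ u → 0 ≤ φinv u)
    (hsub : ∀ x y : Ω → ℝ, IsIntegrableSimpleFunc μ x → IsIntegrableSimpleFunc μ y →
      pphi μ φ φinv (x + y) ≤ pphi μ φ φinv x + pphi μ φ φinv y)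
    (hH : ∀ (k : ℕ) (r s : Fin k → ℝ) (A : Fin k → Set Ω),
      (∀ i, 0 ≤ r i) → (∀ i, 0 ≤ s i) →
      (∀ i, MeasurableSet (A i)) → Pairwise (Function.onFun Disjoint A) →
      (∀ i, μ (A i) ≠ ⊤) →
      Hfun φ φinv (∑ i, (μ (A i)).toReal * r i) (∑ i, (μ (A i)).toReal * s i) ≤
        ∑ i, (μ (A i)).toReal * Hfun φ φinv (r i) (s i)) :
    ∀ r ε : ℝ, 0 < r → 0 < ε → ε < 2 * r →
      ∃ d : ℝ, d ∈ Set.Ioo 0 r ∧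
        φ (r - d + ε / 2) + φ |r - d - ε / 2| = 2 * φ r ∧
        (∀ d' ∈ Set.Ioo (0 : ℝ) r,
          φ (r - d' + ε / 2) + φ |r - d' - ε / 2| = 2 * φ r → d' = d) ∧
        (∀ x y : Ω → ℝ, IsIntegrableSimpleFunc μ x → IsIntegrableSimpleFunc μ y →
          pphi μ φ φinv x ≤ r → pphi μ φ φinv y ≤ r →
          ε ≤ pphi μ φ φinv (x - y) →
          pphi μ φ φinv (fun ω => (x ω + y ω) / 2) ≤ r - d) := by
  have hψ := strictConvexOn_comp_abs hmono hconv
  have hψeven : ∀ t : ℝ, φ |(-t)| = φ |t| := fun t => by rw [abs_neg]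
  have hG := fun v => hψ.strictMonoOn_add_add_sub hψeven v
  have hφnn : ∀ t : ℝ, 0 ≤ φ |t| := fun t => hbij.mapsTo (abs_nonneg t)
  intro r ε hr hε hεr
  have habs : ∀ t : ℝ, 0 ≤ t → φ (t + ε / 2) = φ |t + ε / 2| := fun t ht => by
    rw [abs_of_nonneg (by linarith)]
  have hcont : Continuous (fun t : ℝ => φ |t|) :=
    continuousOn_univ.mp (hψ.convexOn.continuousOn isOpen_univ)
  have hlow : φ |0 + ε / 2| + φ |0 - ε / 2| < 2 * φ r := by
    have h1 : φ (ε / 2) < φ r :=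
      hmono (Set.mem_Ici.mpr (by linarith)) (Set.mem_Ici.mpr hr.le) (by linarith)
    rw [zero_add, zero_sub, abs_neg, abs_of_pos (by linarith : 0 < ε / 2)]
    linarith
  have hhigh : 2 * φ r < φ |r + ε / 2| + φ |r - ε / 2| := by
    have h := hψ.2 (Set.mem_univ (r + ε / 2)) (Set.mem_univ (r - ε / 2))
      (fun h => by linarith) one_half_pos one_half_pos (by norm_num)
    simp only [smul_eq_mul] at h
    rw [show 1 / 2 * (r + ε / 2) + 1 / 2 * (r - ε / 2) = r by ring, abs_of_pos hr] at h
    linarith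
  obtain ⟨t, ht, hteq⟩ : 2 * φ r ∈ (fun t => φ |t + ε / 2| + φ |t - ε / 2|) '' Set.Ioo 0 r :=
    intermediate_value_Ioo hr.le
      ((hcont.comp (continuous_add_const (ε / 2))).add
        (hcont.comp (continuous_sub_right (ε / 2)))).continuousOn ⟨hlow, hhigh⟩
  have hteq : φ |t + ε / 2| + φ |t - ε / 2| = 2 * φ r := hteq
  refine ⟨r - t, ⟨by linarith [ht.2], by linarith [ht.1]⟩, ?_, ?_, ?_⟩
  · rw [sub_sub_cancel, habs t ht.1.le, hteq]
  · intro d' hd' h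
    rw [habs _ (by linarith [hd'.2])] at h
    have := (hG (ε / 2)).injOn (Set.mem_Ici.mpr (by linarith [hd'.2] : 0 ≤ r - d'))
      (Set.mem_Ici.mpr ht.1.le) (h.trans hteq.symm)
    linarith
  intro x y hx hy hxr hyr hxy
  have hInn : ∀ z : Ω → ℝ, 0 ≤ ∫ ω, φ |z ω| ∂μ := fun z => integral_nonneg fun ω => hφnn _
  have hpnn : ∀ z : Ω → ℝ, 0 ≤ pphi μ φ φinv z := fun z => hinvnn _ (hInn z)
  have hball : ∀ z : Ω → ℝ, pphi μ φ φinv z ≤ r → ∫ ω, φ |z ω| ∂μ ≤ φ r := fun z hz => by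
    rw [← hinv2 _ (hInn z)]
    exact hmono.monotoneOn (hpnn z) (Set.mem_Ici.mpr hr.le) hz
  set p := pphi μ φ φinv (fun ω => (x ω + y ω) / 2) with hp
  set q := pphi μ φ φinv (fun ω => (x ω - y ω) / 2) with hq
  have hp0 : 0 ≤ p := hpnn _
  have hqε : ε / 2 ≤ q := by
    have h := hsub _ _ (hx.half_sub hy) (hx.half_sub hy)
    have hdouble : (fun ω => (x ω - y ω) / 2) + (fun ω => (x ω - y ω) / 2) = x - y := by
      funext ω
      simp only [Pi.add_apply, Pi.sub_apply]
      ring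
    rw [hdouble] at h
    linarith
  have hpq : φ |p + q| + φ |p - q| ≤ 2 * φ r := by
    obtain ⟨k, c, A, hAm, hAd, hAfin, hlevels⟩ := hx.exists_common_levels hy
    have h := hH k (fun i => φ |((c i).1 + (c i).2) / 2|) (fun i => φ |((c i).1 - (c i).2) / 2|) A
      (fun i => hφnn _) (fun i => hφnn _) hAm hAd hAfin
    rw [← hlevels (fun a b => φ |(a + b) / 2|) (by simp [hφ0]),
      ← hlevels (fun a b => φ |(a - b) / 2|) (by simp [hφ0])] at h
    simp only [Hfun, hinv1 _ (abs_nonneg _), apply_abs_half_add_add_sub, mul_add,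
      Finset.sum_add_distrib] at h
    rw [← hlevels (fun a _ => φ |a|) (by simp [hφ0]),
      ← hlevels (fun _ b => φ |b|) (by simp [hφ0])] at h
    have h : φ (p + q) + φ |p - q| ≤ ∫ ω, φ |x ω| ∂μ + ∫ ω, φ |y ω| ∂μ := h
    rw [abs_of_nonneg (by linarith : 0 ≤ p + q)]
    linarith [hball x hxr, hball y hyr]
  have hpε : φ |p + ε / 2| + φ |p - ε / 2| ≤ φ |p + q| + φ |p - q| := by
    have h := (hG p).monotoneOn (Set.mem_Ici.mpr (by linarith : 0 ≤ ε / 2))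
      (Set.mem_Ici.mpr (by linarith : 0 ≤ q)) hqε
    simpa only [add_comm _ p, abs_sub_comm _ p] using h
  rw [sub_sub_cancel]
  exact ((hG (ε / 2)).le_iff_le hp0 ht.1.le).mp ((hpε.trans hpq).trans hteq.ge)
end

section
/- Let k ∈ ℕ, let a₁,…,a_k > 0, and let φ : [0,∞) → [0,∞) be a strictly convex bijection (hence strictly increasing with φ(0) = 0). Define p_φ : ℝ^k → [0,∞) by p_φ(x) = φ⁻¹(Σᵢ aᵢ·φ(|xᵢ|)) and assume p_φ is subadditive, i.e. p_φ(x+y) ≤ p_φ(x) + p_φ(y) for all x, y ∈ ℝ^k. Then (ℝ^k, p_φ) is uniformly convex: for every r > 0 and every ε ∈ (0, 2r) there exists δ ∈ (0, r) such that for all x, y ∈ ℝ^k with p_φ(x) ≤ r, p_φ(y) ≤ r and p_φ(x−y) ≥ ε one has p_φ((x+y)/2) ≤ r − δ. -/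
/-- The functional `p_φ(x) = φ⁻¹(Σᵢ aᵢ φ(|xᵢ|))` on `ℝ^k`
(with `φinv` a given inverse of `φ`). -/
noncomputable def pphiFin {k : ℕ} (a : Fin k → ℝ) (φ φinv : ℝ → ℝ)
    (x : Fin k → ℝ) : ℝ :=
  φinv (∑ i, a i * φ |x i|)

theorem StrictMonoOn.comp_abs_midpoint_lt {φ : ℝ → ℝ} (hmono : StrictMonoOn φ (Set.Ici 0))
    (hconv : StrictConvexOn ℝ (Set.Ici 0) φ) {u v : ℝ} (huv : u ≠ v) :
    φ |(u + v) / 2| < (φ |u| + φ |v|) / 2 := by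
  by_cases h : |u| = |v|
  · obtain rfl | rfl := abs_eq_abs.1 h
    · exact absurd rfl huv
    · have hv : v ≠ 0 := fun h0 => huv (by simp [h0])
      have := hmono (Set.mem_Ici.2 le_rfl) (Set.mem_Ici.2 (abs_nonneg v)) (abs_pos.2 hv)
      simpa using this
  · have h1 := hconv.2 (Set.mem_Ici.2 (abs_nonneg u)) (Set.mem_Ici.2 (abs_nonneg v)) h
      (by norm_num : (0 : ℝ) < 1 / 2) (by norm_num : (0 : ℝ) < 1 / 2) (by norm_num)
    simp only [smul_eq_mul] at h1
    have hle : |(u + v) / 2| ≤ 1 / 2 * |u| + 1 / 2 * |v| := by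
      rw [abs_div, abs_two]
      linarith [abs_add_le u v]
    have h2 := hmono.monotoneOn (Set.mem_Ici.2 (abs_nonneg _))
      (Set.mem_Ici.2 ((abs_nonneg _).trans hle)) hle
    linarith

theorem ConvexOn.continuous_comp_abs {φ : ℝ → ℝ} (hmono : MonotoneOn φ (Set.Ici 0))
    (hconv : ConvexOn ℝ (Set.Ici 0) φ) : Continuous fun t : ℝ => φ |t| := by
  have himg : (fun t : ℝ => ‖t‖) '' Set.univ = Set.Ici 0 := by
    ext t
    constructor
    · rintro ⟨s, -, rfl⟩
      exact norm_nonneg s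
    · exact fun ht => ⟨t, trivial, abs_of_nonneg ht⟩
  have hc : ConvexOn ℝ Set.univ (φ ∘ fun t : ℝ => ‖t‖) :=
    ConvexOn.comp (himg.symm ▸ hconv) (convexOn_norm convex_univ) (himg.symm ▸ hmono)
  exact continuousOn_univ.1 (hc.continuousOn isOpen_univ)

theorem isCompact_weighted_sum_sublevel {k : ℕ} {a : Fin k → ℝ} (ha : ∀ i, 0 < a i)
    {φ φinv : ℝ → ℝ} (hmono : StrictMonoOn φ (Set.Ici 0))
    (hnonneg : ∀ t, 0 ≤ t → 0 ≤ φ t) (hinv_nonneg : ∀ u, 0 ≤ u → 0 ≤ φinv u)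
    (hinv : ∀ u : ℝ, 0 ≤ u → φ (φinv u) = u) (hcont : Continuous fun t : ℝ => φ |t|)
    {c : ℝ} (hc : 0 ≤ c) :
    IsCompact {x : Fin k → ℝ | ∑ i, a i * φ |x i| ≤ c} := by
  have hbox : IsCompact (Set.univ.pi fun i : Fin k =>
      Set.Icc (-φinv (c / a i)) (φinv (c / a i))) :=
    isCompact_univ_pi fun _ => isCompact_Icc
  refine hbox.of_isClosed_subset (isClosed_le ?_ continuous_const) ?_
  · exact continuous_finsetSum _ fun i _ =>
      continuous_const.mul (hcont.comp (continuous_apply i))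
  · intro x hx i _
    have hterm : a i * φ |x i| ≤ c :=
      (Finset.single_le_sum (f := fun j => a j * φ |x j|)
        (fun j _ => mul_nonneg (ha j).le (hnonneg _ (abs_nonneg _)))
        (Finset.mem_univ i)).trans hx
    have hci : 0 ≤ c / a i := div_nonneg hc (ha i).le
    refine abs_le.1 ((hmono.le_iff_le (Set.mem_Ici.2 (abs_nonneg _))
      (Set.mem_Ici.2 (hinv_nonneg _ hci))).1 ?_)
    rw [hinv _ hci, le_div_iff₀ (ha i)]
    linarith

/-- For positive weights `aᵢ` and a strictly convex bijection `φ`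
of `[0,∞)` such that `p_φ` is subadditive, the space `(ℝ^k, p_φ)` is uniformly
convex. -/
theorem finite_dim_uniformly_convex (k : ℕ) (a : Fin k → ℝ)
    (ha : ∀ i, 0 < a i) (φ φinv : ℝ → ℝ)
    (hmono : StrictMonoOn φ (Set.Ici 0))
    (hbij : Set.BijOn φ (Set.Ici 0) (Set.Ici 0))
    (hφ0 : φ 0 = 0)
    (hconv : StrictConvexOn ℝ (Set.Ici 0) φ)
    (hinv1 : ∀ t : ℝ, 0 ≤ t → φinv (φ t) = t)
    (hinv2 : ∀ u : ℝ, 0 ≤ u → φ (φinv u) = u)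
    (hsub : ∀ x y : Fin k → ℝ,
      pphiFin a φ φinv (x + y) ≤ pphiFin a φ φinv x + pphiFin a φ φinv y) :
    ∀ r ε : ℝ, 0 < r → 0 < ε → ε < 2 * r →
      ∃ d ∈ Set.Ioo (0 : ℝ) r,
        ∀ x y : Fin k → ℝ,
          pphiFin a φ φinv x ≤ r → pphiFin a φ φinv y ≤ r →
          ε ≤ pphiFin a φ φinv (x - y) →
          pphiFin a φ φinv ((x + y) / 2) ≤ r - d := by
  intro r ε hr hε _
  have hnonneg : ∀ t, 0 ≤ t → 0 ≤ φ t := fun t ht => hbij.mapsTo ht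
  have hinv_nonneg : ∀ u, 0 ≤ u → 0 ≤ φinv u := by
    intro u hu
    obtain ⟨t, ht, rfl⟩ := hbij.surjOn hu
    rw [hinv1 t ht]
    exact ht
  have hle_iff : ∀ u t, 0 ≤ u → 0 ≤ t → (φinv u ≤ t ↔ u ≤ φ t) := by
    intro u t hu ht
    rw [← hmono.le_iff_le (Set.mem_Ici.2 (hinv_nonneg u hu)) (Set.mem_Ici.2 ht), hinv2 u hu]
  have hge_iff : ∀ u t, 0 ≤ u → 0 ≤ t → (t ≤ φinv u ↔ φ t ≤ u) := by
    intro u t hu ht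
    rw [← hmono.le_iff_le (Set.mem_Ici.2 ht) (Set.mem_Ici.2 (hinv_nonneg u hu)), hinv2 u hu]
  have hcont : Continuous fun t : ℝ => φ |t| :=
    hconv.convexOn.continuous_comp_abs hmono.monotoneOn
  set S : (Fin k → ℝ) → ℝ := fun x => ∑ i, a i * φ |x i| with hS
  have hS_nonneg : ∀ x, 0 ≤ S x := fun x =>
    Finset.sum_nonneg fun i _ => mul_nonneg (ha i).le (hnonneg _ (abs_nonneg _))
  have hS_cont : Continuous S := continuous_finsetSum _ fun i _ =>
    continuous_const.mul (hcont.comp (continuous_apply i))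
  have hφε : 0 < φ ε := hφ0 ▸ hmono (Set.mem_Ici.2 le_rfl) (Set.mem_Ici.2 hε.le) hε
  have hB : IsCompact {x | S x ≤ φ r} :=
    isCompact_weighted_sum_sublevel ha hmono hnonneg hinv_nonneg hinv2 hcont (hnonneg r hr.le)
  have hK : IsCompact (({x | S x ≤ φ r} ×ˢ {x | S x ≤ φ r}) ∩
      {q : (Fin k → ℝ) × (Fin k → ℝ) | φ ε ≤ S (q.1 - q.2)}) :=
    (hB.prod hB).inter_right (isClosed_le continuous_const
      (hS_cont.comp (continuous_fst.sub continuous_snd)))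
  have hmid : ∀ x y, S x ≤ φ r → S y ≤ φ r → φ ε ≤ S (x - y) → S ((x + y) / 2) < φ r := by
    intro x y hx hy hxy
    have hne : x ≠ y := by
      rintro rfl
      simp only [hS, sub_self, Pi.zero_apply, abs_zero, hφ0, mul_zero,
        Finset.sum_const_zero] at hxy
      linarith
    obtain ⟨j, hj⟩ := Function.ne_iff.1 hne
    have hlt : ∀ i, x i ≠ y i →
        a i * φ |((x + y) / 2) i| < (a i * φ |x i| + a i * φ |y i|) / 2 := fun i hi => by
      have := mul_lt_mul_of_pos_left (hmono.comp_abs_midpoint_lt hconv hi) (ha i)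
      calc a i * φ |((x + y) / 2) i| < a i * ((φ |x i| + φ |y i|) / 2) := this
        _ = _ := by ring
    have hsum : S ((x + y) / 2) < ∑ i, (a i * φ |x i| + a i * φ |y i|) / 2 := by
      refine Finset.sum_lt_sum (fun i _ => ?_) ⟨j, Finset.mem_univ j, hlt j hj⟩
      by_cases hi : x i = y i
      · simp [hi]
      · exact (hlt i hi).le
    rw [← Finset.sum_div, Finset.sum_add_distrib] at hsum
    change S ((x + y) / 2) < (S x + S y) / 2 at hsum
    linarith
  obtain ⟨m, hm0, hmr, hm⟩ : ∃ m, 0 ≤ m ∧ m < φ r ∧ ∀ x y, S x ≤ φ r → S y ≤ φ r →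
      φ ε ≤ S (x - y) → S ((x + y) / 2) ≤ m := by
    rcases Set.eq_empty_or_nonempty (({x | S x ≤ φ r} ×ˢ {x | S x ≤ φ r}) ∩
      {q : (Fin k → ℝ) × (Fin k → ℝ) | φ ε ≤ S (q.1 - q.2)}) with hemp | hne
    · refine ⟨0, le_rfl, hφ0 ▸ hmono (Set.mem_Ici.2 le_rfl) (Set.mem_Ici.2 hr.le) hr, ?_⟩
      intro x y hx hy hxy
      exact (Set.eq_empty_iff_forall_notMem.1 hemp (x, y) ⟨⟨hx, hy⟩, hxy⟩).elim
    · have hmid_cont : Continuous fun q : (Fin k → ℝ) × (Fin k → ℝ) => S ((q.1 + q.2) / 2) :=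
        hS_cont.comp (continuous_pi fun i => by
          simp only [Pi.div_apply, Pi.add_apply, Pi.ofNat_apply]
          fun_prop)
      obtain ⟨q, ⟨⟨hq1, hq2⟩, hq⟩, hmax⟩ := hK.exists_isMaxOn hne hmid_cont.continuousOn
      exact ⟨_, hS_nonneg _, hmid q.1 q.2 hq1 hq2 hq,
        fun x y hx hy hxy => hmax (a := (x, y)) ⟨⟨hx, hy⟩, hxy⟩⟩
  have hmr' : φinv m < r := lt_of_not_ge fun h =>
    absurd ((hge_iff m r hm0 hr.le).1 h) (not_le.2 hmr)
  refine ⟨min (r - φinv m) (r / 2), ⟨lt_min (by linarith) (by linarith),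
    (min_le_right _ _).trans_lt (by linarith)⟩, ?_⟩
  intro x y hx hy hxy
  have hmxy := hm x y ((hle_iff _ _ (hS_nonneg x) hr.le).1 hx)
    ((hle_iff _ _ (hS_nonneg y) hr.le).1 hy) ((hge_iff _ _ (hS_nonneg _) hε.le).1 hxy)
  have hbound : pphiFin a φ φinv ((x + y) / 2) ≤ φinv m :=
    (hle_iff _ _ (hS_nonneg _) (hinv_nonneg m hm0)).2 ((hinv2 m hm0).symm ▸ hmxy)
  linarith [min_le_left (r - φinv m) (r / 2)]
end

section
/- Let φ(t) = e^t − 1 and define p_φ : ℝ² → [0,∞) by p_φ(x) = log(e^{|x₁|} + e^{|x₂|} − 1). Fix r > 0 and ε ∈ (0, 2r), and let t ∈ [0, r] satisfy e^t − e^{r−t} = e^r − e^{ε/4}. Then for all x, y ∈ ℝ² with p_φ(x) ≤ r, p_φ(y) ≤ r and p_φ(x−y) ≥ ε, one has p_φ((x+y)/2) ≤ log(e^{(t+r)/2} + √(e^r − e^t + 1) − 1), and this bound is strictly less than r. -/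
/-- The paranorm `p_φ(x) = log(e^{|x₁|} + e^{|x₂|} − 1)` on `ℝ²`,
associated with `φ(t) = e^t − 1`. -/
noncomputable def pExp (x : ℝ × ℝ) : ℝ :=
  Real.log (Real.exp |x.1| + Real.exp |x.2| - 1)

open Real in
lemma two_mul_exp_abs_midpoint_add_le (x y : ℝ) :
    2 * exp |(x + y) / 2| + (exp (|x - y| / 2) - 1) ^ 2 / exp (|x - y| / 2) ≤
      exp |x| + exp |y| := by
  have hP : 1 ≤ exp |(x + y) / 2| := one_le_exp (abs_nonneg _)
  have hA : 0 < exp (|x - y| / 2) := exp_pos _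
  have hsum : exp (|(x + y) / 2| + |x - y| / 2) + exp (|(x + y) / 2| - |x - y| / 2) ≤
      exp |x| + exp |y| := by
    have hcases : (|(x + y) / 2| + |x - y| / 2 ≤ |x| ∧ |(x + y) / 2| - |x - y| / 2 ≤ |y|) ∨
        (|(x + y) / 2| + |x - y| / 2 ≤ |y| ∧ |(x + y) / 2| - |x - y| / 2 ≤ |x|) := by
      grind
    rcases hcases with ⟨h₁, h₂⟩ | ⟨h₁, h₂⟩ <;>
      linarith [exp_le_exp.2 h₁, exp_le_exp.2 h₂]
  refine le_trans ?_ hsum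
  rw [exp_add, exp_sub]
  generalize exp |(x + y) / 2| = P at *
  generalize exp (|x - y| / 2) = A at *
  have hdiff : P * A + P / A - (2 * P + (A - 1) ^ 2 / A) = (P - 1) * ((A - 1) ^ 2 / A) := by
    field_simp
    ring
  have hnonneg : 0 ≤ (P - 1) * ((A - 1) ^ 2 / A) :=
    mul_nonneg (by linarith) (by positivity)
  linarith

lemma sq_sub_one_div_le_of_le {E a : ℝ} (hE : 1 ≤ E) (h : E ≤ a) :
    (E - 1) ^ 2 / E ≤ (a - 1) ^ 2 / a := by
  rw [div_le_div_iff₀ (by linarith) (by linarith)]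
  have h₁ : 0 ≤ (a - E) * (a * E - 1) := mul_nonneg (by linarith) (by nlinarith)
  linarith

lemma le_mul_add_of_pow_four_le {R s q : ℝ} (hs : 1 < s) (hq : 0 ≤ q) (hq1 : q ≤ 1)
    (hR : s ^ 4 ≤ R) (h : R * (1 - q ^ 2) = s ^ 2 - 1) :
    R + 1 - (s ^ 2 - 1) ^ 2 / s ^ 2 / 2 ≤ q * R + s := by
  have hqs : s ^ 4 - (s ^ 2 - 1) ≤ q * s ^ 4 := by
    have h₁ : s ^ 4 * (1 - q ^ 2) ≤ R * (1 - q ^ 2) :=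
      mul_le_mul_of_nonneg_right hR (by nlinarith)
    have h₂ : q ^ 2 * s ^ 4 ≤ q * s ^ 4 :=
      mul_le_mul_of_nonneg_right (by nlinarith) (by positivity)
    linarith
  have hc : 0 < s ^ 3 + 3 * s ^ 2 - s - 1 := by nlinarith [pow_pos (sub_pos.2 hs) 3]
  have hpoly : 2 * s ^ 6 * (s + 1) ≤
      (s ^ 3 + 3 * s ^ 2 - s - 1) * (2 * s ^ 4 - s ^ 2 + 1) := by
    obtain ⟨w, hw, rfl⟩ : ∃ w, 0 < w ∧ s = 1 + w := ⟨s - 1, by linarith, by ring⟩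
    rw [← sub_nonneg]
    ring_nf
    positivity
  have hkey : 2 * s ^ 2 * (s + 1) ≤ (s ^ 3 + 3 * s ^ 2 - s - 1) * (1 + q) := by
    refine le_of_mul_le_mul_left ?_ (by positivity : 0 < s ^ 4)
    have := mul_le_mul_of_nonneg_left hqs hc.le
    linarith
  have hRq : R * (1 - q) = (s ^ 2 - 1) / (1 + q) := by
    rw [eq_div_iff (by linarith)]
    linarith
  have hmain : (s ^ 2 - 1) / (1 + q) ≤ (s - 1) * (s ^ 3 + 3 * s ^ 2 - s - 1) / (2 * s ^ 2) := by
    rw [div_le_div_iff₀ (by linarith) (by positivity)]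
    have := mul_le_mul_of_nonneg_left hkey (sub_pos.2 hs).le
    linarith
  have hsplit : (s - 1) * (s ^ 3 + 3 * s ^ 2 - s - 1) / (2 * s ^ 2) =
      s - 1 + (s ^ 2 - 1) ^ 2 / s ^ 2 / 2 := by
    have : s ≠ 0 := by linarith
    field_simp
    ring
  linarith

open Real in
lemma one_le_exp_abs_add_exp_abs_sub_one (x : ℝ × ℝ) : 1 ≤ exp |x.1| + exp |x.2| - 1 := by
  linarith [one_le_exp (abs_nonneg x.1), one_le_exp (abs_nonneg x.2)]

/-- For `φ(t) = e^t − 1` on `ℝ²`, with `t ∈ [0,r]` solving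
`e^t − e^{r−t} = e^r − e^{ε/4}`, any `x, y` with `p_φ(x) ≤ r`, `p_φ(y) ≤ r`,
`p_φ(x−y) ≥ ε` satisfy `p_φ((x+y)/2) ≤ log(e^{(t+r)/2} + √(e^r − e^t + 1) − 1)`,
and this bound is strictly less than `r`. -/
theorem exp_plane_modulus (r ε t : ℝ) (hr : 0 < r) (hε : 0 < ε)
    (hε2 : ε < 2 * r) (ht : t ∈ Set.Icc (0 : ℝ) r)
    (hteq : Real.exp t - Real.exp (r - t) = Real.exp r - Real.exp (ε / 4)) :
    (∀ x y : ℝ × ℝ, pExp x ≤ r → pExp y ≤ r → ε ≤ pExp (x - y) →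
      pExp ((x + y) / 2) ≤
        Real.log (Real.exp ((t + r) / 2) +
          Real.sqrt (Real.exp r - Real.exp t + 1) - 1)) ∧
    Real.log (Real.exp ((t + r) / 2) +
      Real.sqrt (Real.exp r - Real.exp t + 1) - 1) < r := by
  obtain ⟨ht0, htr⟩ := ht
  have htlt : t < r := by
    refine lt_of_le_of_ne htr fun h => ?_
    rw [h, sub_self, Real.exp_zero] at hteq
    linarith [Real.one_lt_exp_iff.2 (by linarith : 0 < ε / 4)]
  set s := Real.sqrt (Real.exp r - Real.exp t + 1) with hs_def
  set q := Real.exp ((t - r) / 2) with hq_def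
  have hTR : Real.exp t < Real.exp r := Real.exp_lt_exp.2 htlt
  have hs2 : s ^ 2 = Real.exp r - Real.exp t + 1 := Real.sq_sqrt (by linarith)
  have hs : 1 < s := by
    rw [hs_def, Real.lt_sqrt one_pos.le]
    linarith
  have hq : 0 < q := Real.exp_pos _
  have hq1 : q < 1 := Real.exp_lt_one_iff.2 (by linarith)
  have hqR : Real.exp ((t + r) / 2) = q * Real.exp r := by
    rw [hq_def, ← Real.exp_add]
    ring_nf
  have hq2 : Real.exp r * (1 - q ^ 2) = s ^ 2 - 1 := by
    have : Real.exp r * q ^ 2 = Real.exp t := by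
      rw [hq_def, ← Real.exp_nat_mul, ← Real.exp_add]
      push_cast
      ring_nf
    linarith
  have hsE : s ^ 2 ≤ Real.exp (ε / 4) := by
    linarith [Real.one_le_exp (by linarith : 0 ≤ r - t)]
  have hE4 : Real.exp (ε / 4) ^ 4 = Real.exp ε := by
    rw [← Real.exp_nat_mul]
    push_cast
    ring_nf
  have hsR : s ^ 4 ≤ Real.exp r := by
    have h₁ : Real.exp (ε / 4) ^ 2 ≤ Real.exp r := by
      rw [← Real.exp_nat_mul]
      exact Real.exp_le_exp.2 (by push_cast; linarith)
    nlinarith [sq_nonneg s]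
  rw [hqR]
  refine ⟨fun x y hx hy hxy => ?_, ?_⟩
  · have hx' := (Real.log_le_iff_le_exp
      (one_pos.trans_le (one_le_exp_abs_add_exp_abs_sub_one x))).1 hx
    have hy' := (Real.log_le_iff_le_exp
      (one_pos.trans_le (one_le_exp_abs_add_exp_abs_sub_one y))).1 hy
    have hxy' := (Real.le_log_iff_exp_le
      (one_pos.trans_le (one_le_exp_abs_add_exp_abs_sub_one (x - y)))).1 hxy
    have h₁ := two_mul_exp_abs_midpoint_add_le x.1 y.1
    have h₂ := two_mul_exp_abs_midpoint_add_le x.2 y.2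
    have hsq (z : ℝ) : Real.exp |z| = Real.exp (|z| / 2) ^ 2 := by
      rw [← Real.exp_nat_mul]
      push_cast
      ring_nf
    rw [← hE4, Prod.fst_sub, Prod.snd_sub, hsq, hsq (x.2 - y.2)] at hxy'
    have hE : 1 ≤ Real.exp (ε / 4) := Real.one_le_exp (by linarith)
    have hlarge : Real.exp (ε / 4) ≤ Real.exp (|x.1 - y.1| / 2) ∨
        Real.exp (ε / 4) ≤ Real.exp (|x.2 - y.2| / 2) := by
      by_contra! h
      have := pow_lt_pow_left₀ h.1 (Real.exp_pos _).le two_ne_zero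
      have := pow_lt_pow_left₀ h.2 (Real.exp_pos _).le two_ne_zero
      nlinarith [sq_nonneg (Real.exp (ε / 4) ^ 2 - 1)]
    have hdefect : (s ^ 2 - 1) ^ 2 / s ^ 2 ≤
        (Real.exp (|x.1 - y.1| / 2) - 1) ^ 2 / Real.exp (|x.1 - y.1| / 2) +
        (Real.exp (|x.2 - y.2| / 2) - 1) ^ 2 / Real.exp (|x.2 - y.2| / 2) := by
      have hs1 : 1 ≤ s ^ 2 := by nlinarith
      have hnonneg (z : ℝ) : 0 ≤ (Real.exp z - 1) ^ 2 / Real.exp z := by positivity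
      rcases hlarge with h | h
      · linarith [sq_sub_one_div_le_of_le hs1 (hsE.trans h), hnonneg (|x.2 - y.2| / 2)]
      · linarith [sq_sub_one_div_le_of_le hs1 (hsE.trans h), hnonneg (|x.1 - y.1| / 2)]
    have hbound := le_mul_add_of_pow_four_le hs hq.le hq1.le hsR hq2
    refine Real.log_le_log
      (one_pos.trans_le (one_le_exp_abs_add_exp_abs_sub_one ((x + y) / 2))) ?_
    change Real.exp |(x.1 + y.1) / 2| + Real.exp |(x.2 + y.2) / 2| - 1 ≤ _
    linarith
  · rw [Real.log_lt_iff_lt_exp (by nlinarith [Real.exp_pos r])]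
    have hfactor : (1 + q) * (Real.exp r * (1 - q) - (s - 1)) = (s - 1) * (s - q) := by
      linear_combination hq2
    have hpos : 0 < (1 + q) * (Real.exp r * (1 - q) - (s - 1)) := by
      rw [hfactor]
      exact mul_pos (by linarith) (by linarith)
    linarith [pos_of_mul_pos_right hpos (by linarith)]
end

section
/- Let φ(t) = e^t − 1 and define p_φ : ℝ² → [0,∞) by p_φ(x) = log(e^{|x₁|} + e^{|x₂|} − 1). Let r > 0 and ε > 0 satisfy e^ε − 1 ≤ 2(e^r − 1). Then: (a) there exists a unique t ∈ [0, r] with e^t − e^{r−t} = e^r − e^ε; and (b) for this t and all x, y ∈ [0,∞)² with p_φ(x) = p_φ(y) = r and p_φ(x − y) = ε, one has p_φ((x+y)/2) ≤ log(e^{(t+r)/2} + √(e^r − e^t + 1) − 1) < r. -/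
/-- For `b, c ≥ 1` with `b + c + δ = R + 1` and `δ * (1 / b + 1 / c) = K`, the value of `δ` is
at least the one attained at `b = 1`, `c = T`, namely `R - T`. -/
lemma sub_le_sub_of_ratio_sum_eq {b c δ R T K : ℝ} (hb : 1 ≤ b) (hc : 1 ≤ c) (hT : 1 ≤ T)
    (hδ : 0 ≤ δ) (hm : b + c + δ = R + 1) (hK : δ * (b + c) = K * (b * c)) (hK0 : 0 < K)
    (hKT : K * T = (R - T) * (T + 1)) : R - T ≤ δ := by
  by_contra! h
  have h1 : K * (b + c - 1) ≤ δ * (b + c) := by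
    rw [hK]
    nlinarith [mul_nonneg (sub_nonneg.2 hb) (sub_nonneg.2 hc)]
  have hT' : T < b + c - 1 := by linarith
  have h2 : (R - T) * (T + 1) * (b + c - 1) ≤ δ * (b + c) * T := by
    rw [← hKT]
    nlinarith
  have h3 : δ * ((b + c) * T) ≤ δ * ((T + 1) * (b + c - 1)) :=
    mul_le_mul_of_nonneg_left (by linarith) hδ
  have h4 : 0 < (R - T - δ) * ((T + 1) * (b + c - 1)) :=
    mul_pos (by linarith) (mul_pos (by linarith) (by linarith))
  linarith

/-- If `P₀² - Q₀² ≤ P² - Q²` and `P₀ / Q₀ ≤ P / Q`, then `P₀ - Q₀ ≤ P - Q`. -/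
lemma sub_le_sub_of_sq_sub_sq_le {P Q P₀ Q₀ : ℝ} (hP : 0 < P) (hQ : 0 < Q) (hP₀ : 0 < P₀)
    (hQ₀ : 0 < Q₀) (hQP₀ : Q₀ ≤ P₀) (hsq : P₀ ^ 2 - Q₀ ^ 2 ≤ P ^ 2 - Q ^ 2)
    (hratio : P₀ * Q ≤ P * Q₀) : P₀ - Q₀ ≤ P - Q := by
  by_contra! h
  have h1 : (P₀ - Q₀) * (P + Q) ≤ (P - Q) * (P₀ + Q₀) := by linarith
  have h2 : (P - Q) * (P₀ + Q₀) < (P₀ - Q₀) * (P₀ + Q₀) :=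
    mul_lt_mul_of_pos_right h (by linarith)
  have h3 : P + Q < P₀ + Q₀ := lt_of_mul_lt_mul_left (h1.trans_lt h2) (by linarith)
  have h4 : (P - Q) * (P + Q) ≤ (P₀ - Q₀) * (P + Q) :=
    mul_le_mul_of_nonneg_right h.le (by linarith)
  have h5 : (P₀ - Q₀) * (P + Q) < (P₀ - Q₀) * (P₀ + Q₀) := by
    refine mul_lt_mul_of_pos_left h3 ?_
    by_contra! h6
    have : P < Q := by linarith
    nlinarith
  linarith

/-- The midpoint estimate in the variables `p = e^{x₁/2}`, `q = e^{x₂/2}`, `u = e^{y₁/2}`,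
`v = e^{y₂/2}`, `ρ = e^{r/2}`, `τ = e^{t/2}`, `E = e^ε`, in the case `y₁ ≤ x₁`. -/
lemma mul_add_mul_le_of_ratio_sum_eq {p q u v ρ τ w E : ℝ} (hp : 1 ≤ p) (hq : 1 ≤ q) (hu : 1 ≤ u)
    (hv : 1 ≤ v) (hτ : 1 ≤ τ) (hw : 1 ≤ w) (hτρ : τ ≤ ρ) (hE : 1 < E)
    (hpq : p ^ 2 + q ^ 2 = ρ ^ 2 + 1) (huv : u ^ 2 + v ^ 2 = ρ ^ 2 + 1)
    (hτw : τ ^ 2 + w ^ 2 = ρ ^ 2 + 1) (hup : u ≤ p)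
    (hxy : p ^ 2 / u ^ 2 + v ^ 2 / q ^ 2 - 1 = E)
    (ht : τ ^ 2 - ρ ^ 2 / τ ^ 2 = ρ ^ 2 - E) :
    p * u + q * v ≤ ρ * τ + w := by
  have hp0 : 0 < p := by linarith
  have hq0 : 0 < q := by linarith
  have hu0 : 0 < u := by linarith
  have hv0 : 0 < v := by linarith
  have hτ0 : 0 < τ := by linarith
  have hw0 : 0 < w := by linarith
  have hρ0 : 0 < ρ := by linarith
  have hδ : 0 ≤ p ^ 2 - u ^ 2 := by nlinarith
  have hK : (p ^ 2 - u ^ 2) * (q ^ 2 + u ^ 2) = (E - 1) * (q ^ 2 * u ^ 2) := by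
    have hv' : v ^ 2 = p ^ 2 + q ^ 2 - u ^ 2 := by linarith
    rw [← hxy, hv']
    field_simp
    ring
  have hKT : (E - 1) * τ ^ 2 = (ρ ^ 2 - τ ^ 2) * (τ ^ 2 + 1) := by
    have hE' : E = ρ ^ 2 - τ ^ 2 + ρ ^ 2 / τ ^ 2 := by linarith
    rw [hE']
    field_simp
    ring
  have hδ₀ : ρ ^ 2 - τ ^ 2 ≤ p ^ 2 - u ^ 2 :=
    sub_le_sub_of_ratio_sum_eq (one_le_pow₀ hq) (one_le_pow₀ hu) (one_le_pow₀ hτ) hδ (by linarith)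
      hK (by linarith) hKT
  have hδ₀' : 0 ≤ ρ ^ 2 - τ ^ 2 := by nlinarith
  have hcross : (ρ ^ 2 - τ ^ 2) * (q ^ 2 * u ^ 2) ≤ (p ^ 2 - u ^ 2) * τ ^ 2 := by
    refine le_of_mul_le_mul_left ?_ (sub_pos.2 hE)
    calc (E - 1) * ((ρ ^ 2 - τ ^ 2) * (q ^ 2 * u ^ 2))
        = (ρ ^ 2 - τ ^ 2) * ((p ^ 2 - u ^ 2) * (q ^ 2 + u ^ 2)) := by rw [hK]; ring
      _ ≤ (ρ ^ 2 - τ ^ 2) * ((p ^ 2 - u ^ 2) * (τ ^ 2 + 1)) := by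
          gcongr ?_ * (?_ * ?_)
          linarith
      _ = (E - 1) * ((p ^ 2 - u ^ 2) * τ ^ 2) := by linear_combination -(p ^ 2 - u ^ 2) * hKT
  have hPQ : (p * v) ^ 2 - (q * u) ^ 2 = (ρ ^ 2 + 1) * (p ^ 2 - u ^ 2) := by
    linear_combination p ^ 2 * huv - u ^ 2 * hpq
  have hPQ₀ : (ρ * w) ^ 2 - τ ^ 2 = (ρ ^ 2 + 1) * (ρ ^ 2 - τ ^ 2) := by
    linear_combination ρ ^ 2 * hτw
  have hratio : (ρ * w) * (q * u) ≤ (p * v) * τ := by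
    refine le_of_sq_le_sq ?_ (by positivity)
    have h1 : ((ρ * w) * (q * u)) ^ 2
        = ((ρ ^ 2 + 1) * (ρ ^ 2 - τ ^ 2) + τ ^ 2) * (q ^ 2 * u ^ 2) := by
      linear_combination (q ^ 2 * u ^ 2) * hPQ₀
    have h2 : ((p * v) * τ) ^ 2
        = ((ρ ^ 2 + 1) * (p ^ 2 - u ^ 2) + q ^ 2 * u ^ 2) * τ ^ 2 := by
      linear_combination τ ^ 2 * hPQ
    rw [h1, h2]
    have := mul_le_mul_of_nonneg_left hcross (by positivity : 0 ≤ ρ ^ 2 + 1)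
    linarith
  have hτρw : τ ≤ ρ * w := by nlinarith
  have hsub : ρ * w - τ ≤ p * v - q * u := by
    refine sub_le_sub_of_sq_sub_sq_le (by positivity) (by positivity) (by positivity)
      (by positivity) hτρw ?_ hratio
    rw [hPQ, hPQ₀]
    gcongr
  have hsub_sq : (ρ * w - τ) ^ 2 ≤ (p * v - q * u) ^ 2 :=
    pow_le_pow_left₀ (by linarith) hsub 2
  refine le_of_sq_le_sq ?_ (by positivity)
  have h1 : (p * u + q * v) ^ 2 = (ρ ^ 2 + 1) ^ 2 - (p * v - q * u) ^ 2 := by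
    linear_combination (u ^ 2 + v ^ 2) * hpq + (ρ ^ 2 + 1) * huv
  have h2 : (ρ * τ + w) ^ 2 = (ρ ^ 2 + 1) ^ 2 - (ρ * w - τ) ^ 2 := by
    linear_combination (ρ ^ 2 + 1) * hτw
  linarith

lemma exp_half_sq (s : ℝ) : Real.exp (s / 2) ^ 2 = Real.exp s := by
  rw [← Real.exp_nat_mul]
  congr 1
  push_cast
  ring

lemma exp_pExp (x : ℝ × ℝ) : Real.exp (pExp x) = Real.exp |x.1| + Real.exp |x.2| - 1 := by
  refine Real.exp_log ?_
  linarith [Real.one_le_exp (abs_nonneg x.1), Real.exp_pos |x.2|]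

lemma pExp_sub_comm (x y : ℝ × ℝ) : pExp (x - y) = pExp (y - x) := by
  simp [pExp, abs_sub_comm]

lemma exp_sub_exp_strictMono (r : ℝ) :
    StrictMono fun t : ℝ => Real.exp t - Real.exp (r - t) := by
  intro s t h
  have h1 := Real.exp_lt_exp.2 h
  have h2 : Real.exp (r - t) < Real.exp (r - s) := Real.exp_lt_exp.2 (by linarith)
  dsimp only
  linarith

/-- The midpoint estimate under the normalization `y₁ ≤ x₁`. -/
lemma pExp_midpoint_le_of_fst_le {r ε t : ℝ} (hε : 0 < ε) (ht0 : 0 ≤ t) (htr : t ≤ r)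
    (ht : Real.exp t - Real.exp (r - t) = Real.exp r - Real.exp ε) {x y : ℝ × ℝ}
    (hx1 : 0 ≤ x.1) (hx2 : 0 ≤ x.2) (hy1 : 0 ≤ y.1) (hy2 : 0 ≤ y.2)
    (hx : pExp x = r) (hy : pExp y = r) (hxy : pExp (x - y) = ε) (hle : y.1 ≤ x.1) :
    pExp ((x + y) / 2) ≤ Real.log (Real.exp ((t + r) / 2) +
      Real.sqrt (Real.exp r - Real.exp t + 1) - 1) := by
  have hX := exp_pExp x
  have hY := exp_pExp y
  have hXY := exp_pExp (x - y)
  rw [hx, abs_of_nonneg hx1, abs_of_nonneg hx2] at hX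
  rw [hy, abs_of_nonneg hy1, abs_of_nonneg hy2] at hY
  have hle2 : x.2 ≤ y.2 := by
    have := Real.exp_le_exp.2 hle
    exact Real.exp_le_exp.1 (by linarith)
  rw [hxy, Prod.fst_sub, Prod.snd_sub, abs_of_nonneg (sub_nonneg.2 hle),
    abs_of_nonpos (sub_nonpos.2 hle2), neg_sub, Real.exp_sub, Real.exp_sub] at hXY
  rw [Real.exp_sub] at ht
  have hT := Real.exp_le_exp.2 htr
  have hone : ∀ s : ℝ, 0 ≤ s → 1 ≤ Real.exp (s / 2) := fun s hs => Real.one_le_exp (by linarith)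
  have key := mul_add_mul_le_of_ratio_sum_eq (p := Real.exp (x.1 / 2)) (q := Real.exp (x.2 / 2))
    (u := Real.exp (y.1 / 2)) (v := Real.exp (y.2 / 2)) (ρ := Real.exp (r / 2))
    (τ := Real.exp (t / 2)) (w := Real.sqrt (Real.exp r - Real.exp t + 1)) (E := Real.exp ε)
    (hone _ hx1) (hone _ hx2) (hone _ hy1) (hone _ hy2) (hone _ ht0)
    (Real.one_le_sqrt.2 (by linarith)) (Real.exp_le_exp.2 (by linarith)) (Real.one_lt_exp_iff.2 hε)
    (by simp only [exp_half_sq]; linarith) (by simp only [exp_half_sq]; linarith)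
    (by rw [Real.sq_sqrt (by linarith)]; simp only [exp_half_sq]; linarith)
    (Real.exp_le_exp.2 (by linarith))
    (by simp only [exp_half_sq]; linarith) (by simp only [exp_half_sq]; linarith)
  simp only [← Real.exp_add] at key
  have e1 : |((x + y) / 2).1| = x.1 / 2 + y.1 / 2 := by
    rw [abs_of_nonneg] <;> simp <;> linarith
  have e2 : |((x + y) / 2).2| = x.2 / 2 + y.2 / 2 := by
    rw [abs_of_nonneg] <;> simp <;> linarith
  have e3 : (t + r) / 2 = r / 2 + t / 2 := by ring
  rw [pExp, e1, e2, e3]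
  refine Real.log_le_log ?_ (by linarith)
  have : 1 ≤ Real.exp (x.1 / 2 + y.1 / 2) := Real.one_le_exp (by linarith)
  linarith [Real.exp_pos (x.2 / 2 + y.2 / 2)]

/-- The upper bound for the midpoint is strictly smaller than `r`. -/
lemma log_midpoint_bound_lt {r t : ℝ} (htr : t < r) :
    Real.log (Real.exp ((t + r) / 2) + Real.sqrt (Real.exp r - Real.exp t + 1) - 1) < r := by
  have hT := Real.exp_lt_exp.2 htr
  have hw : 1 ≤ Real.sqrt (Real.exp r - Real.exp t + 1) := Real.one_le_sqrt.2 (by linarith)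
  have hw2 := Real.sq_sqrt (show 0 ≤ Real.exp r - Real.exp t + 1 by linarith)
  have hh : Real.exp (t / 2) < Real.exp (r / 2) := Real.exp_lt_exp.2 (by linarith)
  rw [Real.log_lt_iff_lt_exp (by linarith [Real.exp_pos ((t + r) / 2)]), add_div, Real.exp_add]
  nlinarith [exp_half_sq t, exp_half_sq r, sq_pos_of_pos (sub_pos.2 hh),
    sq_nonneg (Real.sqrt (Real.exp r - Real.exp t + 1) - 1)]

/-- For `φ(t) = e^t − 1` and `r, ε > 0` with `e^ε − 1 ≤ 2(e^r − 1)`: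
(a) there is a unique `t ∈ [0,r]` with `e^t − e^{r−t} = e^r − e^ε`; (b) for this
`t`, all `x, y` in the first quadrant with `p_φ(x) = p_φ(y) = r` and
`p_φ(x−y) = ε` satisfy `p_φ((x+y)/2) ≤ log(e^{(t+r)/2} + √(e^r − e^t + 1) − 1) < r`. -/
theorem exp_plane_first_quadrant (r ε : ℝ) (hr : 0 < r) (hε : 0 < ε)
    (hcond : Real.exp ε - 1 ≤ 2 * (Real.exp r - 1)) :
    ∃ t ∈ Set.Icc (0 : ℝ) r,
      Real.exp t - Real.exp (r - t) = Real.exp r - Real.exp ε ∧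
      (∀ t' ∈ Set.Icc (0 : ℝ) r,
        Real.exp t' - Real.exp (r - t') = Real.exp r - Real.exp ε → t' = t) ∧
      (∀ x y : ℝ × ℝ, 0 ≤ x.1 → 0 ≤ x.2 → 0 ≤ y.1 → 0 ≤ y.2 →
        pExp x = r → pExp y = r → pExp (x - y) = ε →
        pExp ((x + y) / 2) ≤
          Real.log (Real.exp ((t + r) / 2) +
            Real.sqrt (Real.exp r - Real.exp t + 1) - 1)) ∧
      Real.log (Real.exp ((t + r) / 2) +
        Real.sqrt (Real.exp r - Real.exp t + 1) - 1) < r := by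
  have hE : 1 < Real.exp ε := Real.one_lt_exp_iff.2 hε
  obtain ⟨t, ⟨ht0, htr⟩, ht⟩ : Real.exp r - Real.exp ε ∈
      (fun t : ℝ => Real.exp t - Real.exp (r - t)) '' Set.Icc 0 r := by
    refine intermediate_value_Icc hr.le (by fun_prop) ⟨?_, ?_⟩ <;> simp <;> linarith
  dsimp only at ht
  refine ⟨t, ⟨ht0, htr⟩, ht, fun t' _ ht' =>
    (exp_sub_exp_strictMono r).injective (ht'.trans ht.symm), ?_, ?_⟩
  · intro x y hx1 hx2 hy1 hy2 hx hy hxy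
    rcases le_total y.1 x.1 with h | h
    · exact pExp_midpoint_le_of_fst_le hε ht0 htr ht hx1 hx2 hy1 hy2 hx hy hxy h
    · rw [add_comm x y]
      rw [pExp_sub_comm] at hxy
      exact pExp_midpoint_le_of_fst_le hε ht0 htr ht hy1 hy2 hx1 hx2 hy hx hxy h
  · refine log_midpoint_bound_lt (lt_of_le_of_ne htr ?_)
    rintro rfl
    rw [sub_self, Real.exp_zero] at ht
    linarith
end

section
/- For every real p ∈ (1, 2), the function H : [0,∞)² → [0,∞) defined by H(r, s) = (r^{1/p} + s^{1/p})^p + |r^{1/p} − s^{1/p}|^p is convex on [0,∞)². -/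
open Set Filter Topology

/-- A concave function takes a larger total on the inner pair of two pairs with equal sums. -/
theorem ConcaveOn.add_le_add_of_mem_Icc {f : ℝ → ℝ} {s : Set ℝ} (hf : ConcaveOn ℝ s f)
    {a b c d : ℝ} (ha : a ∈ s) (hd : d ∈ s) (hb : b ∈ Icc a d) (hsum : a + d = b + c) :
    f a + f d ≤ f b + f c := by
  obtain ⟨hab, hbd⟩ := hb
  rcases (hab.trans hbd).eq_or_lt with rfl | had
  · obtain rfl : a = b := le_antisymm hab hbd
    obtain rfl : a = c := by linarith
    exact le_rfl
  · have hpos : 0 < d - a := sub_pos.2 had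
    have h0 : 0 ≤ (d - b) / (d - a) := div_nonneg (by linarith) hpos.le
    have h1 : 0 ≤ (b - a) / (d - a) := div_nonneg (by linarith) hpos.le
    have h01 : (d - b) / (d - a) + (b - a) / (d - a) = 1 := by field_simp; ring
    have hfb := hf.2 ha hd h0 h1 h01
    have hfc := hf.2 hd ha h0 h1 h01
    have eb : ((d - b) / (d - a)) • a + ((b - a) / (d - a)) • d = b := by
      simp only [smul_eq_mul]; field_simp; ring
    have ec : ((d - b) / (d - a)) • d + ((b - a) / (d - a)) • a = c := by
      obtain rfl : c = a + d - b := by linarith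
      simp only [smul_eq_mul]; field_simp; ring
    rw [eb] at hfb
    rw [ec] at hfc
    simp only [smul_eq_mul] at hfb hfc
    calc f a + f d = ((d - b) / (d - a) + (b - a) / (d - a)) * (f a + f d) := by rw [h01, one_mul]
      _ ≤ f b + f c := by linarith

theorem antitoneOn_one_add_rpow_add_signed_rpow {q : ℝ} (hq0 : 0 < q) (hq1 : q ≤ 1) :
    AntitoneOn (fun w : ℝ => (1 + w) ^ q + |1 - w| ^ (q - 1) * (1 - w)) (Ici 0) := by
  have hconc := Real.concaveOn_rpow hq0.le hq1
  have hmul : ∀ x : ℝ, 0 ≤ x → x ^ (q - 1) * x = x ^ q := fun x hx => by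
    rw [← Real.rpow_add_one' hx (by simpa using hq0.ne'), sub_add_cancel]
  have hleft : AntitoneOn (fun w : ℝ => (1 + w) ^ q + |1 - w| ^ (q - 1) * (1 - w))
      (Icc 0 1) := by
    rintro v ⟨hv0, hv1⟩ w ⟨hw0, hw1⟩ hvw
    simp only
    rw [abs_of_nonneg (sub_nonneg.2 hv1), abs_of_nonneg (sub_nonneg.2 hw1),
      hmul _ (sub_nonneg.2 hv1), hmul _ (sub_nonneg.2 hw1)]
    have := hconc.add_le_add_of_mem_Icc (a := 1 - w) (b := 1 - v) (c := 1 + v) (d := 1 + w)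
      (mem_Ici.2 (by linarith)) (mem_Ici.2 (by linarith)) ⟨by linarith, by linarith⟩ (by ring)
    linarith
  have hright : AntitoneOn (fun w : ℝ => (1 + w) ^ q + |1 - w| ^ (q - 1) * (1 - w))
      (Ici 1) := by
    intro v hv w hw hvw
    rw [mem_Ici] at hv hw
    simp only
    rw [abs_sub_comm 1 v, abs_sub_comm 1 w, abs_of_nonneg (sub_nonneg.2 hv),
      abs_of_nonneg (sub_nonneg.2 hw)]
    have h1 := hmul _ (sub_nonneg.2 hv)
    have h2 := hmul _ (sub_nonneg.2 hw)
    have := hconc.add_le_add_of_mem_Icc (a := v - 1) (b := w - 1) (c := 1 + v) (d := 1 + w)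
      (mem_Ici.2 (by linarith)) (mem_Ici.2 (by linarith)) ⟨by linarith, by linarith⟩ (by ring)
    linarith
  have := hleft.union_right hright (isGreatest_Icc zero_le_one) isLeast_Ici
  rwa [Icc_union_Ici_eq_Ici zero_le_one] at this

theorem hasDerivAt_rpow_inv_add_one_rpow_add {p u : ℝ} (hp : 1 < p) (hu : 0 < u) :
    HasDerivAt (fun u : ℝ => (u ^ (1 / p) + 1) ^ p + |u ^ (1 / p) - 1| ^ p)
      ((1 + u ^ (-(1 / p))) ^ (p - 1)
        + |1 - u ^ (-(1 / p))| ^ (p - 1 - 1) * (1 - u ^ (-(1 / p)))) u := by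
  have hp0 : 0 < p := by linarith
  have hz : 0 < u ^ (1 / p) := Real.rpow_pos_of_pos hu _
  have hroot := Real.hasDerivAt_rpow_const (x := u) (p := 1 / p) (Or.inl hu.ne')
  have hplus := (hroot.add_const 1).rpow_const (p := p) (Or.inr hp.le)
  have hminus := (hasDerivAt_abs_rpow (u ^ (1 / p) - 1) hp).comp u (hroot.sub_const 1)
  refine (hplus.add hminus).congr_deriv ?_
  have hpow : u ^ (1 / p - 1) = (u ^ (1 / p)) ^ (1 - p) := by
    rw [← Real.rpow_mul hu.le]; congr 1; field_simp
  rw [hpow, Real.rpow_neg hu.le]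
  generalize u ^ (1 / p) = z at hz
  have e1 : (1 + z⁻¹) = (z + 1) / z := by field_simp
  have e2 : (1 - z⁻¹) = (z - 1) / z := by field_simp
  rw [e1, e2, abs_div, abs_of_pos hz, Real.div_rpow (by positivity) hz.le,
    Real.div_rpow (abs_nonneg _) hz.le, show p - 1 - 1 = p - 2 by ring,
    show (1 : ℝ) - p = -(p - 1) by ring, Real.rpow_neg hz.le,
    show p - 1 = (p - 2) + 1 by ring, Real.rpow_add_one hz.ne']
  have := Real.rpow_pos_of_pos hz (p - 2)
  field_simp

theorem convexOn_rpow_inv_add_one_rpow_add {p : ℝ} (hp1 : 1 < p) (hp2 : p ≤ 2) :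
    ConvexOn ℝ (Ioi 0) (fun u : ℝ => (u ^ (1 / p) + 1) ^ p + |u ^ (1 / p) - 1| ^ p) := by
  have hderiv := fun u (hu : u ∈ Ioi (0 : ℝ)) => hasDerivAt_rpow_inv_add_one_rpow_add hp1 hu
  refine MonotoneOn.convexOn_of_deriv (convex_Ioi 0)
    (fun u hu => (hderiv u hu).continuousAt.continuousWithinAt) ?_ ?_
  · rw [interior_Ioi]
    exact fun u hu => (hderiv u hu).differentiableAt.differentiableWithinAt
  · rw [interior_Ioi]
    intro u hu v hv huv
    rw [(hderiv u hu).deriv, (hderiv v hv).deriv]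
    refine antitoneOn_one_add_rpow_add_signed_rpow (sub_pos.2 hp1) (by linarith)
      (Real.rpow_nonneg (mem_Ioi.1 hv).le _) (Real.rpow_nonneg (mem_Ioi.1 hu).le _) ?_
    exact Real.rpow_le_rpow_of_nonpos hu huv
      (neg_nonpos.2 (one_div_nonneg.2 (by linarith)))

/-- The perspective of a convex function on the positive half-line is convex. -/
theorem ConvexOn.perspective {h : ℝ → ℝ} (hh : ConvexOn ℝ (Ioi 0) h) :
    ConvexOn ℝ (Ioi 0 ×ˢ Ioi 0) (fun q : ℝ × ℝ => q.2 * h (q.1 / q.2)) := by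
  refine ⟨(convex_Ioi 0).prod (convex_Ioi 0), ?_⟩
  rintro ⟨r₁, s₁⟩ ⟨hr₁, hs₁⟩ ⟨r₂, s₂⟩ ⟨hr₂, hs₂⟩ a b ha hb hab
  simp only [mem_Ioi] at hr₁ hs₁ hr₂ hs₂
  simp only [Prod.smul_mk, Prod.mk_add_mk, smul_eq_mul]
  have hS : 0 < a * s₁ + b * s₂ := (convex_Ioi (0 : ℝ)) hs₁ hs₂ ha hb hab
  have key := hh.2 (mem_Ioi.2 (div_pos hr₁ hs₁)) (mem_Ioi.2 (div_pos hr₂ hs₂))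
    (show 0 ≤ a * s₁ / (a * s₁ + b * s₂) by positivity)
    (show 0 ≤ b * s₂ / (a * s₁ + b * s₂) by positivity) (by field_simp)
  have earg : a * s₁ / (a * s₁ + b * s₂) * (r₁ / s₁) + b * s₂ / (a * s₁ + b * s₂) * (r₂ / s₂)
      = (a * r₁ + b * r₂) / (a * s₁ + b * s₂) := by field_simp
  simp only [smul_eq_mul] at key
  rw [earg] at key
  refine (mul_le_mul_of_nonneg_left key hS.le).trans_eq ?_
  field_simp

/-- A continuous function on the plane that is convex on the open quadrant is convex on the closed
quadrant. -/
theorem ConvexOn.Ici_prod_Ici_of_continuous {f : ℝ × ℝ → ℝ}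
    (hf : ConvexOn ℝ (Ioi 0 ×ˢ Ioi 0) f) (hc : Continuous f) :
    ConvexOn ℝ (Ici 0 ×ˢ Ici 0) f := by
  refine ⟨(convex_Ici 0).prod (convex_Ici 0), ?_⟩
  intro x hx y hy a b ha hb hab
  have hmem : ∀ z ∈ Ici (0 : ℝ) ×ˢ Ici (0 : ℝ), ∀ ε > 0, z + (ε, ε) ∈ Ioi (0 : ℝ) ×ˢ Ioi (0 : ℝ) :=
    fun z hz ε hε => ⟨add_pos_of_nonneg_of_pos hz.1 hε, add_pos_of_nonneg_of_pos hz.2 hε⟩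
  have hle : ∀ᶠ ε in 𝓝[>] (0 : ℝ), f (a • (x + (ε, ε)) + b • (y + (ε, ε)))
      ≤ a • f (x + (ε, ε)) + b • f (y + (ε, ε)) := by
    filter_upwards [self_mem_nhdsWithin] with ε hε
    exact hf.2 (hmem x hx ε hε) (hmem y hy ε hε) ha hb hab
  have hl : Continuous fun ε : ℝ => f (a • (x + (ε, ε)) + b • (y + (ε, ε))) := by fun_prop
  have hr : Continuous fun ε : ℝ => a • f (x + (ε, ε)) + b • f (y + (ε, ε)) := by fun_prop
  simpa [← Prod.zero_eq_mk] using
    le_of_tendsto_of_tendsto ((hl.tendsto 0).mono_left nhdsWithin_le_nhds)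
      ((hr.tendsto 0).mono_left nhdsWithin_le_nhds) hle


/-- For `p ∈ (1,2)` the function
`H(r,s) = (r^{1/p} + s^{1/p})^p + |r^{1/p} − s^{1/p}|^p` is convex on `[0,∞)²`. -/
theorem H_power_convex (p : ℝ) (hp1 : 1 < p) (hp2 : p < 2) :
    ConvexOn ℝ (Set.Ici 0 ×ˢ Set.Ici 0)
      (fun q : ℝ × ℝ =>
        (q.1 ^ (1 / p) + q.2 ^ (1 / p)) ^ p + |q.1 ^ (1 / p) - q.2 ^ (1 / p)| ^ p) := by
  have hp0 : 0 < p := by linarith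
  refine ConvexOn.Ici_prod_Ici_of_continuous ?_ ?_
  · refine (convexOn_rpow_inv_add_one_rpow_add hp1 hp2.le).perspective.congr ?_
    rintro ⟨r, s⟩ ⟨hr, hs⟩
    simp only [mem_Ioi] at hr hs ⊢
    have hz : 0 < r ^ (1 / p) := Real.rpow_pos_of_pos hr _
    have hw : 0 < s ^ (1 / p) := Real.rpow_pos_of_pos hs _
    have hs' : s = (s ^ (1 / p)) ^ p := by
      rw [← Real.rpow_mul hs.le, one_div_mul_cancel hp0.ne', Real.rpow_one]
    rw [Real.div_rpow hr.le hs.le]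
    nth_rewrite 1 [hs']
    rw [mul_add, ← Real.mul_rpow hw.le (by positivity), ← Real.mul_rpow hw.le (abs_nonneg _)]
    congr 2
    · field_simp
    · rw [← abs_of_pos hw, ← abs_mul, abs_of_pos hw]
      congr 1
      field_simp
  · have hi : (0 : ℝ) ≤ 1 / p := by positivity
    have h1 : Continuous fun q : ℝ × ℝ => q.1 ^ (1 / p) := continuous_fst.rpow_const fun _ => .inr hi
    have h2 : Continuous fun q : ℝ × ℝ => q.2 ^ (1 / p) := continuous_snd.rpow_const fun _ => .inr hi
    exact ((h1.add h2).rpow_const fun _ => .inr hp0.le).add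
      ((h1.sub h2).abs.rpow_const fun _ => .inr hp0.le)
end
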